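/- The second system of multivariable Wilson polynomials, W̃_n(x) = w_{n_1}(x_1; c + α_{2,s} + N_{2,s}, d + α_{2,s} + N_{2,s}, a, b) · ∏_{k=2}^{s} w_{n_k}(x_k; c + α_{k+1,s} + N_{k+1,s}, d + α_{k+1,s} + N_{k+1,s}, a_k + i x_{k−1}, a_k − i x_{k−1}) (with α_{s+1,s} = N_{s+1,s} = 0), is orthogonal with respect to the same weight ρ(x): ∫_{−∞}^{∞} ⋯ ∫_{−∞}^{∞} W̃_n(x) W̃_m(x) ρ(x) dx_1 ⋯ dx_s = λ̃_n δ_{n,m}, where λ̃_n = (4π)^s [∏_{k=1}^{s} n_k! (N_{k,s} + N_{k+1,s} + 2α_{k,s+1} − 1)_{n_k} Γ(N_{k,s} + N_{k+1,s} + 2α_{k+1,s+1}) Γ(n_k + 2a_k) / Γ(2N_{k,s} + 2α_{k,s+1})] · Γ(a+c+α_{2,s}+N_s) Γ(a+d+α_{2,s}+N_s) Γ(b+c+α_{2,s}+N_s) Γ(b+d+α_{2,s}+N_s), and in the product W̃_n W̃_m the second factor uses the multi-index m with its own partial sums M_{j,k} = ∑_{i=j}^{k} m_i in place of N_{j,k}.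 -/

import Mathlib

open MeasureTheory Classical Complex

noncomputable section

/-- The shifted factorial `(z)_n = z (z+1) ⋯ (z+n-1)`. -/
def pochC (z : ℂ) (n : ℕ) : ℂ := ∏ j ∈ Finset.range n, (z + j)

/-- The Wilson polynomial `w_n(x; a,b,c,d)` of (1.1). -/
def wilsonP (a b c d : ℂ) (n : ℕ) (x : ℝ) : ℂ :=
  pochC (a + b) n * pochC (a + c) n * pochC (a + d) n *
    ∑ k ∈ Finset.range (n + 1),
      pochC (-(n : ℂ)) k * pochC ((n : ℂ) + a + b + c + d - 1) k *
        pochC (a + Complex.I * x) k * pochC (a - Complex.I * x) k /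
      ((k.factorial : ℂ) * pochC (a + b) k * pochC (a + c) k * pochC (a + d) k)

/-- Partial sum `N_{j,k} = n_j + ⋯ + n_k` (empty sum = 0). -/
def psum (n : ℕ → ℕ) (j k : ℕ) : ℕ := ∑ i ∈ Finset.Icc j k, n i

/-- The extended parameter list: `a_1 = (a+b)/2`, `a_{s+1} = (c+d)/2`, and `a_k = ap k`
for `2 ≤ k ≤ s`. -/
def apEx (a b c d : ℂ) (ap : ℕ → ℂ) (s k : ℕ) : ℂ :=
  if k = 1 then (a + b) / 2 else if k = s + 1 then (c + d) / 2 else ap k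

/-- `α_{j,k} = a_j + ⋯ + a_k` (empty sum = 0), using the extended parameter list. -/
def alphaS (a b c d : ℂ) (ap : ℕ → ℂ) (s j k : ℕ) : ℂ :=
  ∑ i ∈ Finset.Icc j k, apEx a b c d ap s i

/-- The weight function `ρ(x)` of (1.5), with one-based variables `x 1, …, x s`. -/
def wilsonRho (a b c d : ℂ) (ap : ℕ → ℂ) (s : ℕ) (x : ℕ → ℝ) : ℂ :=
  Complex.Gamma (a + Complex.I * x 1) * Complex.Gamma (a - Complex.I * x 1) *
      Complex.Gamma (b + Complex.I * x 1) * Complex.Gamma (b - Complex.I * x 1) *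
    (∏ k ∈ Finset.Icc 1 (s - 1),
      Complex.Gamma (ap (k + 1) + Complex.I * x (k + 1) + Complex.I * x k) *
          Complex.Gamma (ap (k + 1) - Complex.I * x (k + 1) - Complex.I * x k) *
          Complex.Gamma (ap (k + 1) + Complex.I * x (k + 1) - Complex.I * x k) *
          Complex.Gamma (ap (k + 1) - Complex.I * x (k + 1) + Complex.I * x k) /
        (Complex.Gamma (2 * Complex.I * x k) * Complex.Gamma (-(2 * Complex.I * x k)))) *
    (Complex.Gamma (c + Complex.I * x s) * Complex.Gamma (c - Complex.I * x s) *
        Complex.Gamma (d + Complex.I * x s) * Complex.Gamma (d - Complex.I * x s) /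
      (Complex.Gamma (2 * Complex.I * x s) * Complex.Gamma (-(2 * Complex.I * x s))))

/-- One-based list of variables `x_1,…,x_s` obtained from a point `y ∈ ℝ^s`. -/
def lift (s : ℕ) (y : Fin s → ℝ) (k : ℕ) : ℝ := if h : k - 1 < s then y ⟨k - 1, h⟩ else 0

/-- The second system `W̃_n(x)` of multivariable Wilson polynomials, (1.7). -/
def mvWilson2 (a b c d : ℂ) (ap : ℕ → ℂ) (s : ℕ) (n : ℕ → ℕ) (x : ℕ → ℝ) : ℂ :=
  wilsonP (c + alphaS a b c d ap s 2 s + psum n 2 s)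
      (d + alphaS a b c d ap s 2 s + psum n 2 s) a b (n 1) (x 1) *
    ∏ k ∈ Finset.Icc 2 s,
      wilsonP (c + alphaS a b c d ap s (k + 1) s + psum n (k + 1) s)
        (d + alphaS a b c d ap s (k + 1) s + psum n (k + 1) s)
        (ap k + Complex.I * x (k - 1)) (ap k - Complex.I * x (k - 1)) (n k) (x k)

/-- The normalization constant `λ̃_n` of (1.8). -/
def lamW2 (a b c d : ℂ) (ap : ℕ → ℂ) (s : ℕ) (n : ℕ → ℕ) : ℂ :=
  ((4 * Real.pi : ℝ) : ℂ) ^ s *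
    (∏ k ∈ Finset.Icc 1 s,
      (Nat.factorial (n k) : ℂ) *
          pochC ((psum n k s : ℂ) + psum n (k + 1) s +
            2 * alphaS a b c d ap s k (s + 1) - 1) (n k) *
          Complex.Gamma ((psum n k s : ℂ) + psum n (k + 1) s +
            2 * alphaS a b c d ap s (k + 1) (s + 1)) *
          Complex.Gamma ((n k : ℂ) + 2 * apEx a b c d ap s k) /
        Complex.Gamma (2 * (psum n k s : ℂ) + 2 * alphaS a b c d ap s k (s + 1))) *
    (Complex.Gamma (a + c + alphaS a b c d ap s 2 s + psum n 1 s) *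
      Complex.Gamma (a + d + alphaS a b c d ap s 2 s + psum n 1 s) *
      Complex.Gamma (b + c + alphaS a b c d ap s 2 s + psum n 1 s) *
      Complex.Gamma (b + d + alphaS a b c d ap s 2 s + psum n 1 s))

/-! ### Gamma bounds -/

lemma norm_beta_le (z : ℂ) (τ : ℝ) (hz : 0 < z.re) (hτ : 0 < τ) :
    ‖Complex.Gamma z‖ * Real.Gamma (z.re + τ) ≤
      Real.Gamma z.re * ‖Complex.Gamma (z + τ)‖ := by
  have h1 := Complex.Gamma_mul_Gamma_eq_betaIntegral (s := z) (t := (τ : ℂ)) hz (by simpa using hτ)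
  have h2 := Complex.Gamma_mul_Gamma_eq_betaIntegral (s := (z.re : ℂ)) (t := (τ : ℂ))
    (by simpa using hz) (by simpa using hτ)
  have h3 : ‖Complex.betaIntegral z τ‖ ≤ ‖Complex.betaIntegral (z.re : ℂ) τ‖ := by
    have hIntg := Complex.betaIntegral_convergent (u := z) (v := (τ : ℂ)) hz (by simpa using hτ)
    have hreal : Complex.betaIntegral (z.re : ℂ) τ =
        ((∫ x in (0:ℝ)..1, x ^ (z.re - 1) * (1 - x) ^ (τ - 1) : ℝ) : ℂ) := by
      unfold Complex.betaIntegral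
      rw [← intervalIntegral.integral_ofReal]
      apply intervalIntegral.integral_congr
      intro x hx
      rw [Set.uIcc_of_le zero_le_one] at hx
      have hx1 : 0 ≤ 1 - x := by linarith [hx.2]
      simp only
      rw [Complex.ofReal_mul, Complex.ofReal_cpow hx.1, Complex.ofReal_cpow hx1]
      push_cast
      rfl
    rw [hreal, Complex.norm_real]
    refine le_trans ?_ (le_abs_self _)
    unfold Complex.betaIntegral
    refine (intervalIntegral.norm_integral_le_integral_norm zero_le_one).trans (le_of_eq ?_)
    rw [intervalIntegral.integral_of_le zero_le_one, intervalIntegral.integral_of_le zero_le_one,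
      integral_Ioc_eq_integral_Ioo, integral_Ioc_eq_integral_Ioo]
    apply setIntegral_congr_fun measurableSet_Ioo
    intro x hx
    have hx1 : 0 < 1 - x := by linarith [hx.2]
    simp only [norm_mul]
    rw [show (1 - (x:ℂ)) = ((1 - x : ℝ) : ℂ) by push_cast; rfl,
      Complex.norm_cpow_eq_rpow_re_of_pos hx.1, Complex.norm_cpow_eq_rpow_re_of_pos hx1]
    simp
  have n1 := congrArg norm h1
  have n2 := congrArg norm h2
  rw [norm_mul, norm_mul] at n1 n2
  rw [← Complex.ofReal_add] at n2
  simp only [Complex.Gamma_ofReal, Complex.norm_real, Real.norm_eq_abs] at n1 n2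
  have p1 := Real.Gamma_pos_of_pos hz
  have p2 := Real.Gamma_pos_of_pos hτ
  have p3 := Real.Gamma_pos_of_pos (add_pos hz hτ)
  rw [abs_of_pos p2] at n1 n2
  rw [abs_of_pos p1, abs_of_pos p3] at n2
  have : (‖Complex.Gamma z‖ * Real.Gamma (z.re + τ)) * Real.Gamma τ ≤
      (Real.Gamma z.re * ‖Complex.Gamma (z + τ)‖) * Real.Gamma τ := by
    calc _ = (‖Complex.Gamma z‖ * Real.Gamma τ) * Real.Gamma (z.re + τ) := by ring
      _ = ‖Complex.Gamma (z + τ)‖ * ‖Complex.betaIntegral z τ‖ * Real.Gamma (z.re + τ) := by rw [n1]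
      _ ≤ ‖Complex.Gamma (z + τ)‖ * ‖Complex.betaIntegral (z.re : ℂ) τ‖ * Real.Gamma (z.re + τ) := by
          gcongr
      _ = ‖Complex.Gamma (z + τ)‖ * (Real.Gamma (z.re + τ) * ‖Complex.betaIntegral (z.re : ℂ) τ‖) := by ring
      _ = ‖Complex.Gamma (z + τ)‖ * (Real.Gamma z.re * Real.Gamma τ) := by rw [n2]
      _ = _ := by ring
  exact le_of_mul_le_mul_right this p2

lemma gamma_half_mul (t : ℝ) :
    Complex.Gamma (1/2 + I * t) * Complex.Gamma (1/2 - I * t) =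
      ((Real.pi / Real.cosh (Real.pi * t) : ℝ) : ℂ) := by
  have := Complex.Gamma_mul_Gamma_one_sub (1/2 + I * t)
  rw [show (1:ℂ) - (1/2 + I * t) = 1/2 - I * t by ring] at this
  rw [this, show (Real.pi : ℂ) * (1/2 + I * t) = (Real.pi * t : ℂ) * I + Real.pi / 2 by ring,
    Complex.sin_add_pi_div_two, Complex.cos_mul_I]
  push_cast
  rfl

lemma norm_gamma_half (t : ℝ) :
    ‖Complex.Gamma (1/2 + I * t)‖ ^ 2 = Real.pi / Real.cosh (Real.pi * t) := by
  have h := gamma_half_mul t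
  have hc : Complex.Gamma (1/2 - I * t) = (starRingEnd ℂ) (Complex.Gamma (1/2 + I * t)) := by
    rw [← Complex.Gamma_conj]
    congr 1
    apply Complex.ext <;> simp
  rw [hc, Complex.mul_conj] at h
  have := Complex.ofReal_injective h
  rw [← this, Complex.normSq_eq_norm_sq]

lemma norm_gamma_half_le (t : ℝ) :
    ‖Complex.Gamma (1/2 + I * t)‖ ≤ 3 * Real.exp (-(Real.pi / 2) * |t|) := by
  have h := norm_gamma_half t
  have hcosh : Real.exp (Real.pi * |t|) / 2 ≤ Real.cosh (Real.pi * t) := by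
    rw [← Real.cosh_abs, abs_mul, abs_of_pos Real.pi_pos, Real.cosh_eq]
    have := Real.exp_pos (-(Real.pi * |t|))
    linarith
  have h2 : ‖Complex.Gamma (1/2 + I * t)‖ ^ 2 ≤ (3 * Real.exp (-(Real.pi / 2) * |t|)) ^ 2 := by
    rw [h, mul_pow, ← Real.exp_nat_mul, div_le_iff₀ (Real.cosh_pos _)]
    have e : Real.exp ((2:ℕ) * (-(Real.pi / 2) * |t|)) * Real.exp (Real.pi * |t|) = 1 := by
      rw [← Real.exp_add]; simp; ring
    have hp := Real.exp_pos ((2:ℕ) * (-(Real.pi / 2) * |t|))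
    have := mul_le_mul_of_nonneg_left hcosh hp.le
    have := Real.pi_lt_four
    nlinarith
  exact (abs_le_of_sq_le_sq' h2 (by positivity)).2

lemma exists_poly_exp (A ε : ℝ) (hA : 0 ≤ A) (hε : 0 < ε) :
    ∃ C > 0, ∀ t : ℝ, 0 ≤ t → A + t ≤ C * Real.exp (ε * t) := by
  refine ⟨A + 1 / ε, by positivity, fun t ht => ?_⟩
  have h1 : 1 ≤ Real.exp (ε * t) := Real.one_le_exp (by positivity)
  have h2 : ε * t ≤ Real.exp (ε * t) := by linarith [Real.add_one_le_exp (ε * t)]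
  have h3 : t ≤ 1 / ε * Real.exp (ε * t) := by
    rw [one_div, inv_mul_eq_div, le_div_iff₀ hε]; linarith
  nlinarith

lemma norm_gamma_half_nat (n : ℕ) : ∀ η : ℝ, η < Real.pi / 2 → ∃ C > 0, ∀ t : ℝ,
    ‖Complex.Gamma (1/2 + I * t + n)‖ ≤ C * Real.exp (-η * |t|) := by
  induction n with
  | zero =>
    intro η hη
    refine ⟨3, by norm_num, fun t => ?_⟩
    have := norm_gamma_half_le t
    simp only [Nat.cast_zero, add_zero]
    refine this.trans ?_
    gcongr
  | succ n ih =>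
    intro η hη
    obtain ⟨C, hC, h⟩ := ih ((η + Real.pi / 2) / 2) (by linarith)
    obtain ⟨D, hD, h'⟩ := exists_poly_exp (1/2 + n) ((Real.pi / 2 - η) / 2) (by positivity)
      (by linarith)
    refine ⟨D * C, by positivity, fun t => ?_⟩
    have hne : (1/2 + I * t + n : ℂ) ≠ 0 := by
      intro h0
      have := congrArg Complex.re h0
      simp at this
      have : (0:ℝ) ≤ n := Nat.cast_nonneg n
      linarith
    have e : (1/2 + I * t + (n + 1 : ℕ) : ℂ) = (1/2 + I * t + n) + 1 := by push_cast; ring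
    rw [e, Complex.Gamma_add_one _ hne, norm_mul]
    have b1 : ‖(1/2 + I * t + n : ℂ)‖ ≤ 1/2 + n + |t| := by
      refine (norm_add_le _ _).trans ?_
      have := norm_add_le (1/2 : ℂ) (I * t)
      simp at this ⊢
      linarith
    calc _ ≤ (D * Real.exp ((Real.pi / 2 - η) / 2 * |t|)) *
          (C * Real.exp (-((η + Real.pi / 2) / 2) * |t|)) := by
            gcongr
            · exact b1.trans (h' _ (abs_nonneg _))
            · exact h t
      _ = D * C * (Real.exp ((Real.pi / 2 - η) / 2 * |t|) *
            Real.exp (-((η + Real.pi / 2) / 2) * |t|)) := by ring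
      _ = _ := by rw [← Real.exp_add]; ring_nf

/-- Exponential decay of Gamma in vertical strips of the right half plane. -/
lemma gamma_decay (σ₀ σ₁ η : ℝ) (h0 : 0 < σ₀) (hη : η < Real.pi / 2) :
    ∃ C > 0, ∀ z : ℂ, σ₀ ≤ z.re → z.re ≤ σ₁ →
      ‖Complex.Gamma z‖ ≤ C * Real.exp (-η * |z.im|) := by
  obtain ⟨N, hN⟩ := exists_nat_gt σ₁
  obtain ⟨C, hC, h⟩ := norm_gamma_half_nat N η hη
  have hcont : ContinuousOn Real.Gamma (Set.Icc σ₀ σ₁) := by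
    intro x hx
    apply (Real.differentiableAt_Gamma _).continuousAt.continuousWithinAt
    intro m hm
    have := hx.1
    have : (0:ℝ) ≤ m := Nat.cast_nonneg m
    linarith
  obtain ⟨M, hM⟩ := isCompact_Icc.exists_bound_of_continuousOn hcont
  have hG : 0 < Real.Gamma (N + 1/2) := Real.Gamma_pos_of_pos (by positivity)
  refine ⟨(|M| + 1) * C / Real.Gamma (N + 1/2), by positivity, fun z hz0 hz1 => ?_⟩
  have hb := norm_beta_le z (N + 1/2 - z.re) (by linarith) (by linarith)
  have e : z + ((N + 1/2 - z.re : ℝ) : ℂ) = 1/2 + I * z.im + N := by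
    apply Complex.ext
    · simp
      ring
    · simp
  rw [e, show z.re + ((N:ℝ) + 1/2 - z.re) = N + 1/2 by ring] at hb
  have hM' := hM z.re ⟨hz0, hz1⟩
  have hM'' : Real.Gamma z.re ≤ |M| + 1 := by
    have := le_abs_self (Real.Gamma z.re)
    have := le_abs_self M
    rw [Real.norm_eq_abs] at hM'
    linarith
  rw [div_mul_eq_mul_div, le_div_iff₀ hG]
  calc _ ≤ _ := hb
    _ ≤ (|M| + 1) * (C * Real.exp (-η * |z.im|)) := by
        gcongr
        exact h _
    _ = _ := by ring

lemma norm_gamma_le_re (z : ℂ) (hz : 0 < z.re) : ‖Complex.Gamma z‖ ≤ Real.Gamma z.re := by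
  rw [Complex.Gamma_eq_integral hz, Real.Gamma_eq_integral hz]
  unfold Complex.GammaIntegral
  refine (norm_integral_le_integral_norm _).trans (le_of_eq ?_)
  apply setIntegral_congr_fun measurableSet_Ioi
  intro x hx
  have hx : 0 < x := hx
  simp only [norm_mul]
  rw [Complex.norm_cpow_eq_rpow_re_of_pos hx, Complex.norm_real, Real.norm_of_nonneg (Real.exp_pos _).le]
  simp

/-! ### One-variable weights -/

/-- `Γ(p+ix)Γ(p-ix)` -/
def gP (p : ℂ) (x : ℝ) : ℂ := Complex.Gamma (p + I * x) * Complex.Gamma (p - I * x)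

/-- `1/(Γ(2ix)Γ(-2ix))` -/
def kW (x : ℝ) : ℂ := (Complex.Gamma (2 * I * x) * Complex.Gamma (-(2 * I * x)))⁻¹

/-- The Wilson weight. -/
def wt (a b c d : ℂ) (x : ℝ) : ℂ := gP a x * gP b x * gP c x * gP d x * kW x

lemma kW_eq (x : ℝ) : kW x = ((2 * x * Real.sinh (2 * Real.pi * x) / Real.pi : ℝ) : ℂ) := by
  unfold kW
  by_cases hx : x = 0
  · subst hx; simp
  have hx' : (2 * I * x : ℂ) ≠ 0 := by simp [hx]
  have h1 := Complex.Gamma_mul_Gamma_one_sub (2 * I * x)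
  have h2 : Complex.Gamma (1 - 2 * I * x) = -(2 * I * x) * Complex.Gamma (-(2 * I * x)) := by
    rw [← Complex.Gamma_add_one _ (neg_ne_zero.mpr hx')]; ring_nf
  rw [h2, show (Real.pi : ℂ) * (2 * I * x) = (2 * Real.pi * x : ℂ) * I by ring,
    Complex.sin_mul_I] at h1
  have h3 : Complex.Gamma (2 * I * x) * Complex.Gamma (-(2 * I * x)) =
      Real.pi / (Complex.sinh (2 * Real.pi * x) * I) / (-(2 * I * x)) := by
    rw [← h1, eq_div_iff (neg_ne_zero.mpr hx')]; ring
  rw [h3]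
  push_cast
  rw [inv_div, div_div_eq_mul_div]
  congr 1
  linear_combination (-2 * (x:ℂ) * Complex.sinh (2 * Real.pi * x)) * Complex.I_mul_I

lemma kW_cont : Continuous kW := by
  have : kW = fun x => ((2 * x * Real.sinh (2 * Real.pi * x) / Real.pi : ℝ) : ℂ) := funext kW_eq
  rw [this]
  fun_prop

lemma abs_sinh_le (t : ℝ) : |Real.sinh t| ≤ Real.exp |t| := by
  rw [Real.abs_sinh, Real.sinh_eq]
  have := Real.exp_pos (-|t|)
  have := Real.exp_pos (|t|)
  linarith

lemma kW_bound (ε : ℝ) (hε : 0 < ε) : ∃ C > 0, ∀ x, ‖kW x‖ ≤ C * Real.exp ((2 * Real.pi + ε) * |x|) := by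
  obtain ⟨D, hD, h⟩ := exists_poly_exp 0 ε le_rfl hε
  refine ⟨2 * D / Real.pi, by have := Real.pi_pos; positivity, fun x => ?_⟩
  rw [kW_eq, Complex.norm_real, Real.norm_eq_abs, abs_div, abs_mul, abs_mul, abs_two,
    abs_of_pos Real.pi_pos]
  have h1 := h |x| (abs_nonneg x)
  have h2 := abs_sinh_le (2 * Real.pi * x)
  rw [abs_mul, abs_of_pos (by have := Real.pi_pos; positivity : 0 < 2 * Real.pi)] at h2
  rw [zero_add] at h1
  calc _ ≤ 2 * (D * Real.exp (ε * |x|)) * Real.exp (2 * Real.pi * |x|) / Real.pi := by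
        have := Real.pi_pos
        gcongr
    _ = 2 * D / Real.pi * (Real.exp (2 * Real.pi * |x|) * Real.exp (ε * |x|)) := by ring
    _ = _ := by rw [← Real.exp_add]; ring_nf

lemma gamma_contAt {z : ℂ} (hz : 0 < z.re) : DifferentiableAt ℂ Complex.Gamma z := by
  apply Complex.differentiableAt_Gamma
  intro m hm
  have := congrArg Complex.re hm
  simp at this
  have : (0:ℝ) ≤ m := Nat.cast_nonneg m
  linarith

lemma gamma_comp_cont {α : Type*} [TopologicalSpace α] {f : α → ℂ} (hf : Continuous f)
    (h : ∀ x, 0 < (f x).re) : Continuous fun x => Complex.Gamma (f x) := by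
  rw [continuous_iff_continuousAt]
  intro x
  exact ContinuousAt.comp (f := f) (gamma_contAt (h x)).continuousAt hf.continuousAt

lemma gP_cont {p : ℂ} (hp : 0 < p.re) : Continuous (gP p) := by
  unfold gP
  refine (gamma_comp_cont (by fun_prop) ?_).mul (gamma_comp_cont (by fun_prop) ?_) <;> simpa using hp

lemma wt_cont {a b c d : ℂ} (ha : 0 < a.re) (hb : 0 < b.re) (hc : 0 < c.re) (hd : 0 < d.re) :
    Continuous (wt a b c d) := by
  unfold wt
  exact ((((gP_cont ha).mul (gP_cont hb)).mul (gP_cont hc)).mul (gP_cont hd)).mul kW_cont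

/-- pair decay, uniformly in the imaginary part of `p`. -/
lemma gP_bound (σ₀ σ₁ η : ℝ) (h0 : 0 < σ₀) (hη0 : 0 ≤ η) (hη : η < Real.pi) :
    ∃ C > 0, ∀ p : ℂ, σ₀ ≤ p.re → p.re ≤ σ₁ → ∀ x : ℝ, ‖gP p x‖ ≤ C * Real.exp (-η * |x|) := by
  obtain ⟨C, hC, h⟩ := gamma_decay σ₀ σ₁ (η / 2) h0 (by linarith)
  refine ⟨C * C, by positivity, fun p hp0 hp1 x => ?_⟩
  unfold gP
  rw [norm_mul]
  have h1 := h (p + I * x) (by simpa using hp0) (by simpa using hp1)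
  have h2 := h (p - I * x) (by simpa using hp0) (by simpa using hp1)
  calc _ ≤ (C * Real.exp (-(η/2) * |(p + I * x).im|)) * (C * Real.exp (-(η/2) * |(p - I * x).im|)) := by
        gcongr
    _ = C * C * Real.exp (-(η/2) * (|(p + I * x).im| + |(p - I * x).im|)) := by
        rw [mul_add, Real.exp_add]; ring
    _ ≤ _ := by
        have e : 2 * |x| ≤ |(p + I * x).im| + |(p - I * x).im| := by
          simp only [add_im, sub_im, mul_im, I_re, I_im, ofReal_re, ofReal_im]
          have := abs_sub (p.im + (0 * 0 + 1 * x)) (p.im - (0 * 0 + 1 * x))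
          rw [show (p.im + (0 * 0 + 1 * x)) - (p.im - (0 * 0 + 1 * x)) = 2 * x by ring, abs_mul,
            abs_two] at this
          exact this
        apply mul_le_mul_of_nonneg_left (Real.exp_le_exp.mpr (by nlinarith)) (by positivity)

lemma gP_bound1 (p : ℂ) (hp : 0 < p.re) (η : ℝ) (hη0 : 0 ≤ η) (hη : η < Real.pi) :
    ∃ C > 0, ∀ x : ℝ, ‖gP p x‖ ≤ C * Real.exp (-η * |x|) := by
  obtain ⟨C, hC, h⟩ := gP_bound p.re p.re η hp hη0 hη
  exact ⟨C, hC, h p le_rfl le_rfl⟩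

lemma integrable_exp_abs (δ : ℝ) (hδ : 0 < δ) : Integrable fun x : ℝ => Real.exp (-δ * |x|) := by
  rw [← integrableOn_univ, ← Set.Iic_union_Ioi (a := (0:ℝ))]
  refine IntegrableOn.union ?_ ?_
  · refine (integrableOn_exp_mul_Iic hδ 0).congr_fun ?_ measurableSet_Iic
    intro x hx
    simp only
    rw [abs_of_nonpos hx]; ring_nf
  · refine (integrableOn_exp_mul_Ioi (a := -δ) (by linarith) 0).congr_fun ?_ measurableSet_Ioi
    intro x hx
    simp only
    rw [abs_of_pos hx]

lemma integrable_of_exp_bound {f : ℝ → ℂ} (hf : Continuous f) {C δ : ℝ} (hδ : 0 < δ)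
    (h : ∀ x, ‖f x‖ ≤ C * Real.exp (-δ * |x|)) : Integrable f :=
  ((integrable_exp_abs δ hδ).const_mul C).mono' hf.aestronglyMeasurable (ae_of_all _ h)

lemma j_bound {b c d : ℂ} (hb : 0 < b.re) (hc : 0 < c.re) (hd : 0 < d.re) :
    ∃ C > 0, ∀ x, ‖gP b x * gP c x * gP d x * kW x‖ ≤ C * Real.exp (-2 * |x|) := by
  have hpi := Real.pi_gt_three
  obtain ⟨B, hB, h1⟩ := gP_bound1 b hb (Real.pi - 1/4) (by linarith) (by linarith)
  obtain ⟨C, hC, h2⟩ := gP_bound1 c hc (Real.pi - 1/4) (by linarith) (by linarith)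
  obtain ⟨D, hD, h3⟩ := gP_bound1 d hd (Real.pi - 1/4) (by linarith) (by linarith)
  obtain ⟨K, hK, h4⟩ := kW_bound (1/4) (by norm_num)
  refine ⟨B * C * D * K, by positivity, fun x => ?_⟩
  simp only [norm_mul]
  calc _ ≤ (B * Real.exp (-(Real.pi - 1/4) * |x|)) * (C * Real.exp (-(Real.pi - 1/4) * |x|)) *
        (D * Real.exp (-(Real.pi - 1/4) * |x|)) * (K * Real.exp ((2 * Real.pi + 1/4) * |x|)) := by
        gcongr
        exacts [h1 x, h2 x, h3 x, h4 x]
    _ = B * C * D * K * Real.exp (-(Real.pi - 1/4) * |x| + -(Real.pi - 1/4) * |x| +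
          -(Real.pi - 1/4) * |x| + (2 * Real.pi + 1/4) * |x|) := by
        simp only [Real.exp_add]; ring
    _ ≤ _ := by
        gcongr
        nlinarith [abs_nonneg x]

lemma wt_bound {a b c d : ℂ} (ha : 0 < a.re) (hb : 0 < b.re) (hc : 0 < c.re) (hd : 0 < d.re) :
    ∃ C > 0, ∀ x, ‖wt a b c d x‖ ≤ C * Real.exp (-4 * |x|) := by
  have hpi := Real.pi_gt_three
  obtain ⟨A, hA, h1⟩ := gP_bound1 a ha 2 (by linarith) (by linarith)
  obtain ⟨J, hJ, h2⟩ := j_bound hb hc hd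
  refine ⟨A * J, by positivity, fun x => ?_⟩
  have : wt a b c d x = gP a x * (gP b x * gP c x * gP d x * kW x) := by unfold wt; ring
  rw [this, norm_mul]
  calc _ ≤ (A * Real.exp (-2 * |x|)) * (J * Real.exp (-2 * |x|)) := by
        gcongr
        exacts [h1 x, h2 x]
    _ = A * J * (Real.exp (-2 * |x|) * Real.exp (-2 * |x|)) := by ring
    _ = _ := by rw [← Real.exp_add]; ring_nf

lemma wt_integrable {a b c d : ℂ} (ha : 0 < a.re) (hb : 0 < b.re) (hc : 0 < c.re) (hd : 0 < d.re) :
    Integrable (wt a b c d) := by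
  obtain ⟨C, _, h⟩ := wt_bound ha hb hc hd
  exact integrable_of_exp_bound (wt_cont ha hb hc hd) (by norm_num) h

/-! ### Contour shift -/

lemma shift_lemma (H : ℂ → ℂ) (hd : ∀ z : ℂ, 0 ≤ z.re → z.re ≤ 1 → DifferentiableAt ℂ H z)
    (C δ : ℝ) (hδ : 0 < δ)
    (hb : ∀ z : ℂ, 0 ≤ z.re → z.re ≤ 1 → ‖H z‖ ≤ C * Real.exp (-δ * |z.im|))
    (hs : ∀ z : ℂ, z.re = 0 → H (1 - z) = - H z) :
    ∫ x : ℝ, H (I * x) = 0 := by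
  have hcont : Continuous fun y : ℝ => H (I * y) := by
    rw [continuous_iff_continuousAt]
    intro x
    exact ContinuousAt.comp (f := fun y : ℝ => I * (y:ℂ)) (hd _ (by simp) (by simp)).continuousAt
      (by fun_prop)
  have hIntg : Integrable fun y : ℝ => H (I * y) :=
    integrable_of_exp_bound hcont hδ (C := C) (fun x => by simpa using hb (I * x) (by simp) (by simp))
  have key : ∀ T : ℝ, 2 * I * ∫ y in (-T)..T, H (I * y) =
      (∫ x in (0:ℝ)..1, H (x + (-T : ℝ) * I)) - ∫ x in (0:ℝ)..1, H (x + T * I) := by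
    intro T
    have h := Complex.integral_boundary_rect_eq_zero_of_differentiableOn H (⟨0, -T⟩) (⟨1, T⟩) (by
      intro z hz
      have h1 := hz.1
      simp only [Set.mem_preimage] at h1
      rw [Set.uIcc_of_le zero_le_one] at h1
      exact (hd z h1.1 h1.2).differentiableWithinAt)
    simp only [smul_eq_mul] at h
    have e1 : (∫ y in (-T)..T, H (((1:ℝ):ℂ) + y * I)) = - ∫ y in (-T)..T, H (I * y) := by
      have : ∀ y : ℝ, H (((1:ℝ):ℂ) + y * I) = - H (I * ((-y : ℝ) : ℂ)) := by
        intro y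
        rw [← hs _ (by simp)]
        congr 1
        push_cast; ring
      simp_rw [this]
      rw [intervalIntegral.integral_neg,
        intervalIntegral.integral_comp_neg (fun y : ℝ => H (I * (y:ℂ)))]
      simp
    have e2 : (∫ y in (-T)..T, H (((0:ℝ):ℂ) + y * I)) = ∫ y in (-T)..T, H (I * y) := by
      congr 1; ext y; congr 1; push_cast; ring
    rw [e1, e2] at h
    linear_combination -h
  have bnd : ∀ T : ℝ, ‖∫ x in (0:ℝ)..1, H (x + T * I)‖ ≤ C * Real.exp (-δ * |T|) := by
    intro T
    have := intervalIntegral.norm_integral_le_of_norm_le_const (a := (0:ℝ)) (b := 1)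
      (f := fun x : ℝ => H (x + T * I)) (C := C * Real.exp (-δ * |T|)) (by
        intro x hx
        rw [Set.uIoc_of_le zero_le_one] at hx
        have := hb (x + T * I) (by simpa using hx.1.le) (by simpa using hx.2)
        simpa using this)
    simpa using this
  have lim1 := MeasureTheory.intervalIntegral_tendsto_integral hIntg Filter.tendsto_neg_atTop_atBot Filter.tendsto_id
  have lim0 : Filter.Tendsto (fun T : ℝ => 2 * I * ∫ y in (-T)..T, H (I * y)) Filter.atTop (nhds 0) := by
    rw [tendsto_zero_iff_norm_tendsto_zero]
    have hexp : Filter.Tendsto (fun T : ℝ => 2 * C * Real.exp (-δ * |T|)) Filter.atTop (nhds 0) := by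
      have : Filter.Tendsto (fun T : ℝ => Real.exp (-δ * |T|)) Filter.atTop (nhds 0) := by
        apply Real.tendsto_exp_atBot.comp
        exact Filter.Tendsto.const_mul_atTop_of_neg (by linarith) Filter.tendsto_abs_atTop_atTop
      simpa using this.const_mul (2 * C)
    refine squeeze_zero (fun _ => norm_nonneg _) (fun T => ?_) hexp
    rw [key T]
    refine (norm_sub_le _ _).trans ?_
    have h1 := bnd (-T)
    have h2 := bnd T
    rw [abs_neg] at h1
    linarith
  have lim2 := lim1.const_mul (2 * I)
  have := tendsto_nhds_unique lim0 lim2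
  simpa using this.symm

/-! ### Functional equation of the Wilson integral -/

lemma norm_sin_le (w : ℂ) : ‖Complex.sin w‖ ≤ Real.exp |w.im| := by
  have h1 : ‖Complex.exp (-w * I)‖ ≤ Real.exp |w.im| := by
    rw [Complex.norm_exp]; simp [le_abs_self]
  have h2 : ‖Complex.exp (w * I)‖ ≤ Real.exp |w.im| := by
    rw [Complex.norm_exp]; simp [neg_le_abs]
  have h3 := norm_sub_le (Complex.exp (-w * I)) (Complex.exp (w * I))
  unfold Complex.sin
  simp only [norm_mul, norm_div, Complex.norm_I, Complex.norm_ofNat]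
  linarith

/-- pair used in the contour shift -/
def pairS (p z : ℂ) : ℂ := Complex.Gamma (p + z) * Complex.Gamma (p + 1 - z)

lemma pairS_symm (p z : ℂ) : pairS p (1 - z) = pairS p z := by
  unfold pairS
  rw [mul_comm]
  ring_nf

lemma pairS_diff {p z : ℂ} (hp : 0 < p.re) (h0 : 0 ≤ z.re) (h1 : z.re ≤ 1) :
    DifferentiableAt ℂ (pairS p) z := by
  unfold pairS
  refine DifferentiableAt.mul ?_ ?_
  · exact DifferentiableAt.comp (g := Complex.Gamma) (f := fun z => p + z) z
      (gamma_contAt (by simp; linarith)) (by fun_prop)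
  · exact DifferentiableAt.comp (g := Complex.Gamma) (f := fun z => p + 1 - z) z
      (gamma_contAt (by simp; linarith)) (by fun_prop)

lemma pairS_bound {p : ℂ} (hp : 0 < p.re) (η : ℝ) (hη0 : 0 ≤ η) (hη : η < Real.pi) :
    ∃ C > 0, ∀ z : ℂ, 0 ≤ z.re → z.re ≤ 1 → ‖pairS p z‖ ≤ C * Real.exp (-η * |z.im|) := by
  obtain ⟨C, hC, h⟩ := gamma_decay p.re (p.re + 1) (η / 2) hp (by linarith)
  refine ⟨C * C, by positivity, fun z hz0 hz1 => ?_⟩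
  unfold pairS
  rw [norm_mul]
  have h1 := h (p + z) (by simp; linarith) (by simp; linarith)
  have h2 := h (p + 1 - z) (by simp; linarith) (by simp; linarith)
  calc _ ≤ (C * Real.exp (-(η/2) * |(p + z).im|)) * (C * Real.exp (-(η/2) * |(p + 1 - z).im|)) := by
        gcongr
    _ = C * C * Real.exp (-(η/2) * (|(p + z).im| + |(p + 1 - z).im|)) := by
        rw [mul_add, Real.exp_add]; ring
    _ ≤ _ := by
        have e : 2 * |z.im| ≤ |(p + z).im| + |(p + 1 - z).im| := by
          simp only [add_im, sub_im, one_im]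
          have := abs_sub (p.im + z.im) (p.im + 0 - z.im)
          rw [show (p.im + z.im) - (p.im + 0 - z.im) = 2 * z.im by ring, abs_mul,
            abs_two] at this
          exact this
        apply mul_le_mul_of_nonneg_left (Real.exp_le_exp.mpr (by nlinarith)) (by positivity)

lemma nz_re {z : ℂ} (hz : 0 < z.re) : z ≠ 0 := by
  rintro rfl; simp at hz

lemma pairS_I {p : ℂ} (hp : 0 < p.re) (x : ℝ) : pairS p (I * x) = (p - I * x) * gP p x := by
  unfold pairS gP
  rw [show p + 1 - I * x = (p - I * x) + 1 by ring,
    Complex.Gamma_add_one _ (nz_re (by simpa using hp))]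
  ring

lemma gP_neg (p : ℂ) (x : ℝ) : gP p (-x) = gP p x := by
  unfold gP
  rw [mul_comm]
  push_cast
  ring_nf

lemma gP_add_one {p : ℂ} (hp : 0 < p.re) (x : ℝ) : gP (p + 1) x = (p ^ 2 + x ^ 2) * gP p x := by
  unfold gP
  rw [show p + 1 - I * x = (p - I * x) + 1 by ring, show p + 1 + I * x = (p + I * x) + 1 by ring,
    Complex.Gamma_add_one _ (nz_re (by simpa using hp)),
    Complex.Gamma_add_one _ (nz_re (by simpa using hp))]
  linear_combination (-(x:ℂ) ^ 2 * Complex.Gamma (p + I * x) * Complex.Gamma (p - I * x)) * Complex.I_sq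

lemma wt_comm12 (a b c d : ℂ) : wt a b c d = wt b a c d := by ext x; unfold wt; ring
lemma wt_comm13 (a b c d : ℂ) : wt a b c d = wt c b a d := by ext x; unfold wt; ring
lemma wt_comm14 (a b c d : ℂ) : wt a b c d = wt d b c a := by ext x; unfold wt; ring

lemma wt_add_one {a : ℂ} (b c d : ℂ) (ha : 0 < a.re) (x : ℝ) :
    wt (a + 1) b c d x = (a ^ 2 + x ^ 2) * wt a b c d x := by
  unfold wt
  rw [gP_add_one ha]; ring

lemma contour_identity {a b c d : ℂ} (ha : 0 < a.re) (hb : 0 < b.re) (hc : 0 < c.re)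
    (hd : 0 < d.re) :
    ∫ x : ℝ, ((a * b * c + a * b * d + a * c * d + b * c * d) - (a + b + c + d) * (x : ℂ) ^ 2) *
      wt a b c d x = 0 := by
  have hpi := Real.pi_gt_three
  set H : ℂ → ℂ := fun z => pairS a z * pairS b z * pairS c z * pairS d z *
    Complex.sin (2 * Real.pi * z) with hH
  obtain ⟨A, hA, h1⟩ := pairS_bound ha (Real.pi - 1/4) (by linarith) (by linarith)
  obtain ⟨B, hB, h2⟩ := pairS_bound hb (Real.pi - 1/4) (by linarith) (by linarith)
  obtain ⟨C, hC, h3⟩ := pairS_bound hc (Real.pi - 1/4) (by linarith) (by linarith)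
  obtain ⟨D, hD, h4⟩ := pairS_bound hd (Real.pi - 1/4) (by linarith) (by linarith)
  have hdiff : ∀ z : ℂ, 0 ≤ z.re → z.re ≤ 1 → DifferentiableAt ℂ H z := by
    intro z h0 h1
    refine DifferentiableAt.mul (((((pairS_diff ha h0 h1).mul (pairS_diff hb h0 h1)).mul
      (pairS_diff hc h0 h1))).mul (pairS_diff hd h0 h1)) ?_
    fun_prop
  have hbd : ∀ z : ℂ, 0 ≤ z.re → z.re ≤ 1 → ‖H z‖ ≤ (A * B * C * D) * Real.exp (-2 * |z.im|) := by
    intro z hz0 hz1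
    simp only [hH, norm_mul]
    have h5 := norm_sin_le (2 * Real.pi * z)
    have e : (2 * (Real.pi : ℂ) * z).im = 2 * Real.pi * z.im := by simp
    rw [e, abs_mul, abs_of_pos (by linarith : 0 < 2 * Real.pi)] at h5
    calc _ ≤ (A * Real.exp (-(Real.pi - 1/4) * |z.im|)) * (B * Real.exp (-(Real.pi - 1/4) * |z.im|)) *
          (C * Real.exp (-(Real.pi - 1/4) * |z.im|)) * (D * Real.exp (-(Real.pi - 1/4) * |z.im|)) *
          Real.exp (2 * Real.pi * |z.im|) := by
          gcongr
          exacts [h1 z hz0 hz1, h2 z hz0 hz1, h3 z hz0 hz1, h4 z hz0 hz1]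
      _ = A * B * C * D * Real.exp (-(Real.pi - 1/4) * |z.im| + -(Real.pi - 1/4) * |z.im| +
          -(Real.pi - 1/4) * |z.im| + -(Real.pi - 1/4) * |z.im| + 2 * Real.pi * |z.im|) := by
          simp only [Real.exp_add]; ring
      _ ≤ _ := by
          apply mul_le_mul_of_nonneg_left (Real.exp_le_exp.mpr ?_) (by positivity)
          nlinarith [abs_nonneg z.im]
  have hsym : ∀ z : ℂ, z.re = 0 → H (1 - z) = - H z := by
    intro z _
    simp only [hH, pairS_symm]
    rw [show 2 * (Real.pi:ℂ) * (1 - z) = 2 * Real.pi - 2 * Real.pi * z by ring,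
      Complex.sin_two_pi_sub]
    ring
  have hz := shift_lemma H hdiff _ 2 (by norm_num) hbd hsym
  have hcontH : Continuous fun y : ℝ => H (I * y) := by
    rw [continuous_iff_continuousAt]
    intro x
    exact ContinuousAt.comp (f := fun y : ℝ => I * (y:ℂ)) (hdiff _ (by simp) (by simp)).continuousAt
      (by fun_prop)
  have hIntg : Integrable fun y : ℝ => H (I * y) :=
    integrable_of_exp_bound hcontH two_pos (C := A * B * C * D)
      (fun x => by simpa using hbd (I * x) (by simp) (by simp))
  have hz2 : ∫ x : ℝ, H (I * ((-x : ℝ) : ℂ)) = 0 := by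
    rw [integral_neg_eq_self (fun x : ℝ => H (I * (x : ℂ)))]; exact hz
  have hIntg2 : Integrable fun x : ℝ => H (I * ((-x : ℝ) : ℂ)) := hIntg.comp_neg
  have hsum : ∫ x : ℝ, (H (I * x) + H (I * ((-x : ℝ) : ℂ))) = 0 := by
    rw [integral_add hIntg hIntg2, hz, hz2, add_zero]
  have hpt : ∀ x : ℝ, H (I * x) + H (I * ((-x : ℝ) : ℂ)) =
      (Real.pi : ℂ) * (((a * b * c + a * b * d + a * c * d + b * c * d) -
        (a + b + c + d) * (x : ℂ) ^ 2) * wt a b c d x) := by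
    intro x
    simp only [hH]
    rw [pairS_I ha, pairS_I hb, pairS_I hc, pairS_I hd, pairS_I ha, pairS_I hb, pairS_I hc,
      pairS_I hd]
    simp only [gP_neg]
    have hs1 : Complex.sin (2 * Real.pi * (I * x)) = Complex.sinh (2 * Real.pi * x) * I := by
      rw [← Complex.sin_mul_I]; ring_nf
    have hs2 : Complex.sin (2 * Real.pi * (I * ((-x : ℝ) : ℂ))) = - (Complex.sinh (2 * Real.pi * x) * I) := by
      rw [← Complex.sin_mul_I, ← Complex.sin_neg]; push_cast; ring_nf
    rw [hs1, hs2]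
    unfold wt
    rw [kW_eq]
    push_cast
    have hpi0 : (Real.pi : ℂ) ≠ 0 := by exact_mod_cast Real.pi_ne_zero
    field_simp
    have hI := Complex.I_sq
    ring_nf
    have hI4 : I ^ 4 = 1 := by rw [show I ^ 4 = (I ^ 2) ^ 2 by ring, hI]; norm_num
    rw [hI, hI4]
    ring
  simp_rw [hpt] at hsum
  rw [integral_const_mul] at hsum
  have hpi0 : (Real.pi : ℂ) ≠ 0 := by exact_mod_cast Real.pi_ne_zero
  exact (mul_eq_zero.mp hsum).resolve_left hpi0

lemma sum_ne_zero4 {a b c d : ℂ} (ha : 0 < a.re) (hb : 0 < b.re) (hc : 0 < c.re)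
    (hd : 0 < d.re) : a + b + c + d ≠ 0 :=
  nz_re (by simp; linarith)

lemma func_eq {a b c d : ℂ} (ha : 0 < a.re) (hb : 0 < b.re) (hc : 0 < c.re)
    (hd : 0 < d.re) :
    (a + b + c + d) * ∫ x, wt (a + 1) b c d x =
      (a + b) * (a + c) * (a + d) * ∫ x, wt a b c d x := by
  have h := contour_identity ha hb hc hd
  have i1 := wt_integrable ha hb hc hd
  have i2 := wt_integrable (a := a + 1) (by simp; linarith) hb hc hd
  have : ∀ x : ℝ, ((a * b * c + a * b * d + a * c * d + b * c * d) - (a + b + c + d) * (x : ℂ) ^ 2) *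
      wt a b c d x = (a + b) * (a + c) * (a + d) * wt a b c d x -
        (a + b + c + d) * wt (a + 1) b c d x := by
    intro x
    rw [wt_add_one b c d ha]; ring
  simp_rw [this] at h
  rw [integral_sub (i1.const_mul _) (i2.const_mul _), integral_const_mul, integral_const_mul] at h
  linear_combination -h

/-! ### Evaluation of the Wilson integral up to a constant -/

lemma pochC_zero (z : ℂ) : pochC z 0 = 1 := by simp [pochC]
lemma pochC_succ (z : ℂ) (n : ℕ) : pochC z (n + 1) = pochC z n * (z + n) := by
  simp [pochC, Finset.prod_range_succ]
lemma re_add_nat_pos {z : ℂ} (hz : 0 < z.re) (n : ℕ) : 0 < (z + n).re := by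
  have : (0:ℝ) ≤ n := Nat.cast_nonneg n
  simp; linarith
lemma pochC_ne_zero {z : ℂ} (hz : 0 < z.re) (n : ℕ) : pochC z n ≠ 0 := by
  unfold pochC
  rw [Finset.prod_ne_zero_iff]
  intro j _
  exact nz_re (re_add_nat_pos hz j)
lemma gamma_pochC {z : ℂ} (hz : 0 < z.re) (n : ℕ) :
    Complex.Gamma (z + n) = pochC z n * Complex.Gamma z := by
  induction n with
  | zero => simp [pochC_zero]
  | succ n ih =>
    rw [pochC_succ, Nat.cast_succ, ← add_assoc, Complex.Gamma_add_one _ (nz_re (re_add_nat_pos hz n)), ih]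
    ring
lemma gamma_nz {z : ℂ} (hz : 0 < z.re) : Complex.Gamma z ≠ 0 :=
  Complex.Gamma_ne_zero_of_re_pos hz

lemma func_eq_iter {a b c d : ℂ} (ha : 0 < a.re) (hb : 0 < b.re) (hc : 0 < c.re)
    (hd : 0 < d.re) (n : ℕ) :
    pochC (a + b + c + d) n * ∫ x, wt (a + n) b c d x =
      pochC (a + b) n * pochC (a + c) n * pochC (a + d) n * ∫ x, wt a b c d x := by
  induction n with
  | zero => simp [pochC_zero]
  | succ n ih =>
    have h := func_eq (re_add_nat_pos ha n) hb hc hd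
    simp only [pochC_succ]
    rw [Nat.cast_succ, ← add_assoc]
    calc _ = pochC (a + b + c + d) n * ((a + n + b + c + d) * ∫ x, wt (a + n + 1) b c d x) := by ring
      _ = _ := by
        rw [h]
        linear_combination (a + n + b) * (a + n + c) * (a + n + d) * ih

lemma gammaSeq_pochC (s : ℂ) (n : ℕ) : Complex.GammaSeq s n = (n:ℂ) ^ s * n.factorial / pochC s (n + 1) := by
  unfold Complex.GammaSeq pochC; rfl

lemma gamma_ratio {s : ℂ} (hs : 0 < s.re) {n : ℕ} (hn : n ≠ 0) :
    Complex.Gamma (s + (n + 1 : ℕ)) / ((n:ℂ) ^ s * n.factorial) =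
      Complex.Gamma s / Complex.GammaSeq s n := by
  have h1 : (n:ℂ) ^ s ≠ 0 := by
    rw [Complex.cpow_ne_zero_iff]; left; exact_mod_cast hn
  have h2 : (n.factorial : ℂ) ≠ 0 := by exact_mod_cast n.factorial_ne_zero
  have h3 := pochC_ne_zero hs (n + 1)
  rw [gamma_pochC hs, gammaSeq_pochC]
  field_simp

lemma gamma_ratio_tendsto {s : ℂ} (hs : 0 < s.re) :
    Filter.Tendsto (fun n : ℕ => Complex.Gamma (s + (n + 1 : ℕ)) / ((n:ℂ) ^ s * n.factorial))
      Filter.atTop (nhds 1) := by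
  have h := (tendsto_const_nhds (x := Complex.Gamma s)).div (Complex.GammaSeq_tendsto_Gamma s) (gamma_nz hs)
  rw [div_self (gamma_nz hs)] at h
  refine h.congr' ?_
  filter_upwards [Filter.eventually_ne_atTop 0] with n hn
  rw [gamma_ratio hs hn]
  rfl

/-- three parameter weight -/
def jt (b c d : ℂ) (x : ℝ) : ℂ := gP b x * gP c x * gP d x * kW x

lemma jt_cont {b c d : ℂ} (hb : 0 < b.re) (hc : 0 < c.re) (hd : 0 < d.re) :
    Continuous (jt b c d) := by
  unfold jt
  exact ((((gP_cont hb)).mul (gP_cont hc)).mul (gP_cont hd)).mul kW_cont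

lemma wt_eq_jt (a b c d : ℂ) (x : ℝ) : wt a b c d x = gP a x * jt b c d x := by
  unfold wt jt; ring

lemma lim_kernel {a b c d : ℂ} (ha : 0 < a.re) (hb : 0 < b.re) (hc : 0 < c.re)
    (hd : 0 < d.re) :
    Filter.Tendsto (fun n : ℕ => ∫ x, gP (a + (n + 1 : ℕ)) x / ((n:ℂ) ^ a * n.factorial) ^ 2 * jt b c d x)
      Filter.atTop (nhds (∫ x, jt b c d x)) := by
  obtain ⟨C, hC, hbd⟩ := j_bound hb hc hd
  have hbd' : ∀ x, ‖jt b c d x‖ ≤ C * Real.exp (-2 * |x|) := hbd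
  have hre : Filter.Tendsto (fun n : ℕ => ‖Complex.Gamma ((a.re : ℂ) + (n + 1 : ℕ)) /
      ((n:ℂ) ^ (a.re : ℂ) * n.factorial)‖) Filter.atTop (nhds 1) := by
    simpa using (gamma_ratio_tendsto (s := (a.re : ℂ)) (by simpa using ha)).norm
  have hle := hre.eventually (gt_mem_nhds (by norm_num : (1:ℝ) < 2))
  apply tendsto_integral_filter_of_dominated_convergence (fun x => 4 * (C * Real.exp (-2 * |x|)))
  · refine Filter.Eventually.of_forall fun n => ?_
    exact (((gP_cont (re_add_nat_pos ha (n+1))).div_const _).mul (jt_cont hb hc hd)).aestronglyMeasurable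
  · filter_upwards [hle, Filter.eventually_ne_atTop 0] with n hn hn0
    refine ae_of_all _ fun x => ?_
    rw [norm_mul]
    have hnpos : 0 < (n:ℝ) := by exact_mod_cast Nat.pos_of_ne_zero hn0
    have e1 : ∀ s : ℂ, ‖(n:ℂ) ^ s‖ = (n:ℝ) ^ s.re := by
      intro s
      have := Complex.norm_cpow_eq_rpow_re_of_pos hnpos s
      simpa using this
    have hG : ∀ z : ℂ, z.re = a.re → ‖Complex.Gamma (z + (n + 1 : ℕ))‖ ≤
        2 * ((n:ℝ) ^ a.re * n.factorial) := by
      intro z hz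
      have h1 := norm_gamma_le_re (z + (n+1:ℕ)) (re_add_nat_pos (by rw [hz]; exact ha) (n+1))
      rw [norm_div, norm_mul, e1, Complex.norm_natCast, div_lt_iff₀ (by positivity)] at hn
      rw [show ((a.re:ℂ) + (n+1:ℕ)) = ((a.re + (n+1:ℕ) : ℝ) : ℂ) by push_cast; rfl,
        Complex.Gamma_ofReal, Complex.norm_real, Real.norm_eq_abs] at hn
      have h2 : (z + (n+1:ℕ)).re = a.re + (n+1:ℕ) := by rw [← hz]; simp
      rw [h2] at h1
      refine h1.trans ((le_abs_self _).trans ?_)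
      simpa using hn.le
    have hg : ‖gP (a + (n + 1 : ℕ)) x / ((n:ℂ) ^ a * n.factorial) ^ 2‖ ≤ 4 := by
      unfold gP
      rw [norm_div, norm_mul, norm_pow, norm_mul, e1, Complex.norm_natCast, div_le_iff₀ (by positivity)]
      have g1 := hG (a + I * x) (by simp)
      have g2 := hG (a - I * x) (by simp)
      rw [show a + I * x + (n+1:ℕ) = a + (n+1:ℕ) + I * x by ring] at g1
      rw [show a - I * x + (n+1:ℕ) = a + (n+1:ℕ) - I * x by ring] at g2
      calc _ ≤ (2 * ((n:ℝ) ^ a.re * n.factorial)) * (2 * ((n:ℝ) ^ a.re * n.factorial)) := by gcongr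
        _ = _ := by ring
    gcongr
    exact hbd' x
  · exact ((integrable_exp_abs 2 two_pos).const_mul C).const_mul 4
  · refine ae_of_all _ fun x => ?_
    have t1 := gamma_ratio_tendsto (s := a + I * x) (by simpa using ha)
    have t2 := gamma_ratio_tendsto (s := a - I * x) (by simpa using ha)
    have t3 := (t1.mul t2).mul_const (jt b c d x)
    simp only [one_mul] at t3
    refine t3.congr' ?_
    filter_upwards [Filter.eventually_ne_atTop 0] with n hn0
    have hn : (n:ℂ) ≠ 0 := by exact_mod_cast hn0
    congr 1
    unfold gP
    rw [div_mul_div_comm, show a + I * x + (n+1:ℕ) = a + (n+1:ℕ) + I * x by ring,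
      show a - I * x + (n+1:ℕ) = a + (n+1:ℕ) - I * x by ring]
    congr 1
    have : (n:ℂ) ^ (a + I * x) * (n:ℂ) ^ (a - I * x) = (n:ℂ) ^ a * (n:ℂ) ^ a := by
      rw [← Complex.cpow_add _ _ hn, ← Complex.cpow_add _ _ hn]; ring_nf
    linear_combination (n.factorial : ℂ) ^ 2 * this

lemma wilson_J {a b c d : ℂ} (ha : 0 < a.re) (hb : 0 < b.re) (hc : 0 < c.re)
    (hd : 0 < d.re) :
    ∫ x, wt a b c d x = Complex.Gamma (a + b) * Complex.Gamma (a + c) * Complex.Gamma (a + d) /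
      Complex.Gamma (a + b + c + d) * ∫ x, jt b c d x := by
  have hab : 0 < (a + b).re := by simp; linarith
  have hac : 0 < (a + c).re := by simp; linarith
  have had : 0 < (a + d).re := by simp; linarith
  have hσ : 0 < (a + b + c + d).re := by simp; linarith
  have L := ((((Complex.GammaSeq_tendsto_Gamma (a + b)).mul (Complex.GammaSeq_tendsto_Gamma (a + c))).mul
    (Complex.GammaSeq_tendsto_Gamma (a + d))).div (Complex.GammaSeq_tendsto_Gamma (a + b + c + d))
    (gamma_nz hσ)).mul (lim_kernel ha hb hc hd)
  refine tendsto_nhds_unique (tendsto_const_nhds (x := ∫ x, wt a b c d x) (f := Filter.atTop (α := ℕ))) ?_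
  refine L.congr' ?_
  filter_upwards [Filter.eventually_ne_atTop 0] with n hn0
  have hn : (n:ℂ) ≠ 0 := by exact_mod_cast hn0
  have hf : (n.factorial : ℂ) ≠ 0 := by exact_mod_cast n.factorial_ne_zero
  have hna : ∀ s : ℂ, (n:ℂ) ^ s ≠ 0 := fun s => by
    rw [Complex.cpow_ne_zero_iff]; left; exact hn
  have e : ∫ x, gP (a + (n + 1 : ℕ)) x / ((n:ℂ) ^ a * n.factorial) ^ 2 * jt b c d x =
      (∫ x, wt (a + (n + 1 : ℕ)) b c d x) / ((n:ℂ) ^ a * n.factorial) ^ 2 := by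
    rw [← integral_div]
    congr 1; ext x; rw [wt_eq_jt]; ring
  have hfe := func_eq_iter ha hb hc hd (n + 1)
  simp only [Pi.div_apply]
  rw [e]
  simp only [gammaSeq_pochC]
  have p1 := pochC_ne_zero hab (n + 1)
  have p2 := pochC_ne_zero hac (n + 1)
  have p3 := pochC_ne_zero had (n + 1)
  have p4 := pochC_ne_zero hσ (n + 1)
  have q : (n:ℂ) ^ (a + b) * (n:ℂ) ^ (a + c) * (n:ℂ) ^ (a + d) =
      (n:ℂ) ^ (a + b + c + d) * ((n:ℂ) ^ a) ^ 2 := by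
    rw [sq, ← Complex.cpow_add _ _ hn, ← Complex.cpow_add _ _ hn, ← Complex.cpow_add _ _ hn,
      ← Complex.cpow_add _ _ hn]
    ring_nf
  have q4 := hna (a + b + c + d)
  have qa := hna a
  have hI : ∫ x, wt (a + (n + 1 : ℕ)) b c d x = pochC (a + b) (n+1) * pochC (a + c) (n+1) *
      pochC (a + d) (n+1) * (∫ x, wt a b c d x) / pochC (a + b + c + d) (n+1) := by
    rw [← hfe]; field_simp
  rw [hI]
  generalize (n:ℂ) ^ (a + b) = X1 at *
  generalize (n:ℂ) ^ (a + c) = X2 at *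
  generalize (n:ℂ) ^ (a + d) = X3 at *
  generalize (n:ℂ) ^ (a + b + c + d) = X4 at *
  generalize (n:ℂ) ^ a = X5 at *
  field_simp
  linear_combination (∫ x, wt a b c d x) * q

lemma jt_comm12 (b c d : ℂ) : jt b c d = jt c b d := by ext x; unfold jt; ring
lemma jt_comm13 (b c d : ℂ) : jt b c d = jt d c b := by ext x; unfold jt; ring

lemma jt_swap {a b c d : ℂ} (ha : 0 < a.re) (hb : 0 < b.re) (hc : 0 < c.re)
    (hd : 0 < d.re) :
    Complex.Gamma (a + c) * Complex.Gamma (a + d) * (∫ x, jt b c d x) =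
    Complex.Gamma (b + c) * Complex.Gamma (b + d) * (∫ x, jt a c d x) := by
  have h1 := wilson_J ha hb hc hd
  have h2 := wilson_J hb ha hc hd
  rw [wt_comm12, h2, add_comm b a] at h1
  have g1 := gamma_nz (z := a + b) (by simp; linarith)
  have g2 := gamma_nz (z := a + b + c + d) (by simp; linarith)
  field_simp at h1
  linear_combination -h1

/-- the Wilson integral up to a universal constant -/
lemma wilson_exists_const : ∃ K : ℂ, ∀ a b c d : ℂ, 0 < a.re → 0 < b.re → 0 < c.re → 0 < d.re →
    ∫ x, wt a b c d x = K * (Complex.Gamma (a + b) * Complex.Gamma (a + c) * Complex.Gamma (a + d) *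
      Complex.Gamma (b + c) * Complex.Gamma (b + d) * Complex.Gamma (c + d)) /
      Complex.Gamma (a + b + c + d) := by
  have one : 0 < (1:ℂ).re := by simp
  refine ⟨(∫ x, jt 1 1 1 x) / Complex.Gamma (1 + 1) ^ 3, fun a b c d ha hb hc hd => ?_⟩
  have s1 := jt_swap (a := 1) one hb hc hd
  have s2 := jt_swap (a := 1) one hc one hd
  have s3 := jt_swap (a := 1) one hd one one
  rw [jt_comm12 c 1 d] at s2
  rw [jt_comm13 d 1 1] at s3
  rw [wilson_J ha hb hc hd]
  have g1 := gamma_nz (z := 1 + c) (by simp; linarith)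
  have g2 := gamma_nz (z := 1 + d) (by simp; linarith)
  have g3 := gamma_nz (z := 1 + 1) (by simp)
  have g4 := gamma_nz (z := a + b + c + d) (by simp; linarith)
  rw [add_comm c 1] at s2
  rw [add_comm d 1] at s3
  have t3 : ∫ x, jt 1 1 d x = Complex.Gamma (1 + d) ^ 2 * (∫ x, jt 1 1 1 x) / Complex.Gamma (1+1) ^ 2 := by
    rw [eq_div_iff (pow_ne_zero _ g3)]; linear_combination s3
  have t2 : ∫ x, jt 1 c d x = Complex.Gamma (1 + c) * Complex.Gamma (c + d) *
      (∫ x, jt 1 1 d x) / (Complex.Gamma (1+1) * Complex.Gamma (1 + d)) := by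
    rw [eq_div_iff (mul_ne_zero g3 g2)]; linear_combination s2
  have t1 : ∫ x, jt b c d x = Complex.Gamma (b + c) * Complex.Gamma (b + d) *
      (∫ x, jt 1 c d x) / (Complex.Gamma (1 + c) * Complex.Gamma (1 + d)) := by
    rw [eq_div_iff (mul_ne_zero g1 g2)]; linear_combination s1
  rw [t1, t2, t3]
  field_simp

/-! ### The constant -/

lemma gP_half (x : ℝ) : gP (1/2) x = ((Real.pi / Real.cosh (Real.pi * x) : ℝ) : ℂ) :=
  gamma_half_mul x

lemma half_re : 0 < (1/2 : ℂ).re := by norm_num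

lemma integral_sech_sq : ∫ x : ℝ, (gP (1/2) x) ^ 2 = 2 * Real.pi := by
  have hder : ∀ x : ℝ, HasDerivAt (fun x : ℝ => Real.pi * (Real.sinh (Real.pi * x) / Real.cosh (Real.pi * x)))
      ((Real.pi / Real.cosh (Real.pi * x)) ^ 2) x := by
    intro x
    have hlin : HasDerivAt (fun x : ℝ => Real.pi * x) Real.pi x := by
      simpa using (hasDerivAt_id x).const_mul Real.pi
    have h1 := (Real.hasDerivAt_sinh (Real.pi * x)).comp x hlin
    have h2 := (Real.hasDerivAt_cosh (Real.pi * x)).comp x hlin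
    have hc := (Real.cosh_pos (Real.pi * x)).ne'
    have h3 := (h1.div h2 hc).const_mul Real.pi
    refine h3.congr_deriv ?_
    simp only [Function.comp]
    have := Real.cosh_sq (Real.pi * x)
    field_simp
    linear_combination this
  have htop : Filter.Tendsto (fun x : ℝ => Real.pi * (Real.sinh (Real.pi * x) / Real.cosh (Real.pi * x)))
      Filter.atTop (nhds Real.pi) := by
    have e : ∀ x : ℝ, Real.pi * (Real.sinh (Real.pi * x) / Real.cosh (Real.pi * x)) =
        Real.pi * ((1 - Real.exp (-(2 * Real.pi * x))) / (1 + Real.exp (-(2 * Real.pi * x)))) := by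
      intro x
      have hE := Real.exp_pos (Real.pi * x)
      have h2 : Real.exp (-(2 * Real.pi * x)) = (Real.exp (Real.pi * x))⁻¹ ^ 2 := by
        rw [← Real.exp_neg, ← Real.exp_nat_mul]; congr 1; push_cast; ring
      rw [Real.sinh_eq, Real.cosh_eq, h2, Real.exp_neg]
      field_simp
    simp_rw [e]
    have hz : Filter.Tendsto (fun x : ℝ => Real.exp (-(2 * Real.pi * x))) Filter.atTop (nhds 0) := by
      apply Real.tendsto_exp_neg_atTop_nhds_zero.comp
      exact Filter.tendsto_id.const_mul_atTop (by have := Real.pi_pos; positivity)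
    have := ((hz.const_sub 1).div (hz.const_add 1) (by norm_num)).const_mul Real.pi
    simpa using this
  have hbot : Filter.Tendsto (fun x : ℝ => Real.pi * (Real.sinh (Real.pi * x) / Real.cosh (Real.pi * x)))
      Filter.atBot (nhds (-Real.pi)) := by
    have := (htop.comp Filter.tendsto_neg_atBot_atTop).neg
    refine this.congr fun x => ?_
    simp [Real.sinh_neg, Real.cosh_neg, neg_div]
  have hIntg : Integrable fun x : ℝ => (Real.pi / Real.cosh (Real.pi * x)) ^ 2 := by
    obtain ⟨C, hC, h⟩ := gP_bound1 (1/2) half_re 1 (by norm_num) (by have := Real.pi_gt_three; linarith)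
    refine ((integrable_exp_abs 2 two_pos).const_mul (C * C)).mono' ?_ (ae_of_all _ fun x => ?_)
    · have : Continuous fun x : ℝ => (Real.pi / Real.cosh (Real.pi * x)) ^ 2 := by
        have : ∀ x : ℝ, Real.cosh (Real.pi * x) ≠ 0 := fun x => (Real.cosh_pos _).ne'
        fun_prop (disch := assumption)
      exact this.aestronglyMeasurable
    · have := h x
      rw [gP_half, Complex.norm_real] at this
      rw [norm_pow]
      calc _ ≤ (C * Real.exp (-1 * |x|)) ^ 2 := by gcongr
        _ = C * C * (Real.exp (-1 * |x|) * Real.exp (-1 * |x|)) := by ring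
        _ = _ := by rw [← Real.exp_add]; ring_nf
  have := integral_of_hasDerivAt_of_tendsto hder hIntg hbot htop
  simp_rw [gP_half, ← Complex.ofReal_pow]
  rw [integral_complex_ofReal, this]
  push_cast; ring

lemma wt_special (x : ℝ) : wt 1 (1/2) (1/2) (1/2) x = 4 * Real.pi * x ^ 2 * (gP (1/2) x) ^ 2 := by
  suffices h : gP 1 x * gP (1/2) x * kW x = 4 * Real.pi * x ^ 2 by
    unfold wt; linear_combination (gP (1/2) x) ^ 2 * h
  by_cases hx : x = 0
  · subst hx; simp [kW_eq]
  have hx' : (I * x : ℂ) ≠ 0 := by simp [hx]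
  have hxc : (x : ℂ) ≠ 0 := by simp [hx]
  have h1 : gP 1 x = Real.pi * x / Complex.sinh (Real.pi * x) := by
    unfold gP
    rw [add_comm, Complex.Gamma_add_one _ hx', mul_assoc, Complex.Gamma_mul_Gamma_one_sub,
      show (Real.pi:ℂ) * (I * x) = (Real.pi * x : ℂ) * I by ring, Complex.sin_mul_I]
    field_simp
  have hs : Complex.sinh (Real.pi * x) ≠ 0 := by
    rw [← Complex.ofReal_mul, ← Complex.ofReal_sinh]
    have : Real.sinh (Real.pi * x) ≠ 0 := by
      rw [Ne, Real.sinh_eq_zero]; simp [hx, Real.pi_ne_zero]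
    exact_mod_cast this
  have hc : Complex.cosh (Real.pi * x) ≠ 0 := by
    rw [← Complex.ofReal_mul, ← Complex.ofReal_cosh]
    exact_mod_cast (Real.cosh_pos _).ne'
  have hp : (Real.pi : ℂ) ≠ 0 := by exact_mod_cast Real.pi_ne_zero
  rw [h1, gP_half, kW_eq]
  push_cast
  rw [show 2 * (Real.pi:ℂ) * x = 2 * (Real.pi * x) by ring, Complex.sinh_two_mul]
  field_simp
  ring

lemma wt_special_integral : ∫ x, wt 1 (1/2) (1/2) (1/2) x = 2 * Real.pi ^ 2 / 3 := by
  set H : ℂ → ℂ := fun z => (1/2 - z) * (pairS (1/2) z) ^ 2 with hH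
  have hdiff : ∀ z : ℂ, 0 ≤ z.re → z.re ≤ 1 → DifferentiableAt ℂ H z := by
    intro z h0 h1
    exact DifferentiableAt.mul (by fun_prop) ((pairS_diff half_re h0 h1).pow 2)
  obtain ⟨C, hC, h⟩ := pairS_bound (p := 1/2) half_re 2 (by norm_num) (by have := Real.pi_gt_three; linarith)
  obtain ⟨D, hD, h'⟩ := exists_poly_exp 1 1 (by norm_num) (by norm_num)
  have hbd : ∀ z : ℂ, 0 ≤ z.re → z.re ≤ 1 → ‖H z‖ ≤ (D * C ^ 2) * Real.exp (-3 * |z.im|) := by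
    intro z h0 h1
    have b1 : ‖1/2 - z‖ ≤ D * Real.exp (1 * |z.im|) := by
      refine (Complex.norm_le_abs_re_add_abs_im _).trans (le_trans ?_ (h' _ (abs_nonneg _)))
      have e1 : |(1/2 - z).re| ≤ 1 := by
        rw [abs_le]; constructor <;> norm_num <;> linarith
      have e2 : |(1/2 - z).im| = |z.im| := by simp
      linarith
    simp only [hH, norm_mul, norm_pow]
    calc _ ≤ (D * Real.exp (1 * |z.im|)) * (C * Real.exp (-2 * |z.im|)) ^ 2 := by
          gcongr; exact h z h0 h1
      _ = D * C ^ 2 * Real.exp (1 * |z.im| + -2 * |z.im| + -2 * |z.im|) := by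
          simp only [Real.exp_add]; ring
      _ = _ := by ring_nf
  have hsym : ∀ z : ℂ, z.re = 0 → H (1 - z) = - H z := by
    intro z _
    simp only [hH, pairS_symm]
    ring
  have hz := shift_lemma H hdiff _ 3 (by norm_num) hbd hsym
  have hcontH : Continuous fun y : ℝ => H (I * y) := by
    rw [continuous_iff_continuousAt]
    intro x
    exact ContinuousAt.comp (f := fun y : ℝ => I * (y:ℂ)) (hdiff _ (by simp) (by simp)).continuousAt
      (by fun_prop)
  have hIntg : Integrable fun y : ℝ => H (I * y) :=
    integrable_of_exp_bound hcontH three_pos (C := D * C ^ 2)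
      (fun x => by simpa using hbd (I * x) (by simp) (by simp))
  have hz2 : ∫ x : ℝ, H (I * ((-x : ℝ) : ℂ)) = 0 := by
    rw [integral_neg_eq_self (fun x : ℝ => H (I * (x : ℂ)))]; exact hz
  have hIntg2 : Integrable fun x : ℝ => H (I * ((-x : ℝ) : ℂ)) := hIntg.comp_neg
  have hsum : ∫ x : ℝ, (H (I * x) + H (I * ((-x : ℝ) : ℂ))) = 0 := by
    rw [integral_add hIntg hIntg2, hz, hz2, add_zero]
  have hpi0 : (Real.pi : ℂ) ≠ 0 := by exact_mod_cast Real.pi_ne_zero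
  have hpt : ∀ x : ℝ, H (I * x) + H (I * ((-x : ℝ) : ℂ)) =
      (1/4) * (gP (1/2) x) ^ 2 - 3 / (4 * Real.pi) * wt 1 (1/2) (1/2) (1/2) x := by
    intro x
    simp only [hH]
    rw [pairS_I half_re, pairS_I half_re, gP_neg, wt_special]
    push_cast
    field_simp
    ring_nf
    rw [Complex.I_sq]
    ring
  simp_rw [hpt] at hsum
  have i1 : Integrable fun x => (gP (1/2) x) ^ 2 := by
    obtain ⟨C, hC, h⟩ := gP_bound1 (1/2) half_re 1 (by norm_num) (by have := Real.pi_gt_three; linarith)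
    refine integrable_of_exp_bound ((gP_cont half_re).pow 2) (C := C * C) two_pos fun x => ?_
    rw [norm_pow]
    calc _ ≤ (C * Real.exp (-1 * |x|)) ^ 2 := by gcongr; exact h x
        _ = C * C * (Real.exp (-1 * |x|) * Real.exp (-1 * |x|)) := by ring
        _ = _ := by rw [← Real.exp_add]; ring_nf
  have i2 := wt_integrable (a := 1) (by simp) half_re half_re half_re
  rw [integral_sub (i1.const_mul _) (i2.const_mul _), integral_const_mul, integral_const_mul,
    integral_sech_sq] at hsum
  field_simp at hsum
  linear_combination -(1/3) * hsum

/-- The de Branges–Wilson integral. -/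
lemma wilson_integral {a b c d : ℂ} (ha : 0 < a.re) (hb : 0 < b.re) (hc : 0 < c.re) (hd : 0 < d.re) :
    ∫ x, wt a b c d x = 4 * Real.pi * (Complex.Gamma (a + b) * Complex.Gamma (a + c) * Complex.Gamma (a + d) *
      Complex.Gamma (b + c) * Complex.Gamma (b + d) * Complex.Gamma (c + d)) /
      Complex.Gamma (a + b + c + d) := by
  obtain ⟨K, hK⟩ := wilson_exists_const
  have hpi0 : (Real.pi : ℂ) ≠ 0 := by exact_mod_cast Real.pi_ne_zero
  have h := hK 1 (1/2) (1/2) (1/2) (by simp) half_re half_re half_re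
  rw [wt_special_integral] at h
  have g1 : Complex.Gamma (1/2) ^ 2 = Real.pi := by
    have := gamma_half_mul 0
    simp at this
    rw [sq]; simpa using this
  have g2 : Complex.Gamma (1 + 1/2) = 1/2 * Complex.Gamma (1/2) := by
    rw [add_comm, Complex.Gamma_add_one _ (by norm_num)]
  have g3 : Complex.Gamma (1 + 1/2 + 1/2 + 1/2) = 3/2 * (1/2 * Complex.Gamma (1/2)) := by
    rw [← g2, ← show (1:ℂ) + 1/2 = 3/2 by norm_num, ← Complex.Gamma_add_one _ (by norm_num)]
    norm_num
  have g4 : Complex.Gamma (1/2 + 1/2) = 1 := by norm_num [Complex.Gamma_one]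
  have gh := gamma_nz half_re
  rw [g2, g3, g4] at h
  have hK4 : K = 4 * Real.pi := by
    field_simp at h
    rw [g1] at h
    have : (Real.pi : ℂ) * (K - 4 * Real.pi) = 0 := by linear_combination -h
    exact sub_eq_zero.mp ((mul_eq_zero.mp this).resolve_left hpi0)
  rw [hK a b c d ha hb hc hd, hK4]

/-! ### Functions of sub-exponential growth -/

/-- sub-exponential growth with respect to a gauge `N` -/
def SubExp {α : Type*} (N : α → ℝ) (f : α → ℂ) : Prop :=
  ∀ ε : ℝ, 0 < ε → ∃ C : ℝ, 0 < C ∧ ∀ t, ‖f t‖ ≤ C * Real.exp (ε * N t)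

/-- linear growth with respect to a gauge `N` -/
def LinB {α : Type*} (N : α → ℝ) (f : α → ℂ) : Prop :=
  ∃ K : ℝ, 0 ≤ K ∧ ∀ t, ‖f t‖ ≤ K * (1 + N t)

section growth
variable {α : Type*} {N : α → ℝ} {f g : α → ℂ}

lemma LinB.const (hN : ∀ t, 0 ≤ N t) (z : ℂ) : LinB N (fun _ => z) :=
  ⟨‖z‖, norm_nonneg _, fun t => by nlinarith [hN t, norm_nonneg z]⟩

lemma LinB.add (hf : LinB N f) (hg : LinB N g) : LinB N (fun t => f t + g t) := by
  obtain ⟨K, hK, h1⟩ := hf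
  obtain ⟨L, hL, h2⟩ := hg
  refine ⟨K + L, by positivity, fun t => (norm_add_le _ _).trans ?_⟩
  linarith [h1 t, h2 t]

lemma LinB.neg (hf : LinB N f) : LinB N (fun t => - f t) := by
  obtain ⟨K, hK, h1⟩ := hf
  exact ⟨K, hK, fun t => by rw [norm_neg]; exact h1 t⟩

lemma LinB.sub (hf : LinB N f) (hg : LinB N g) : LinB N (fun t => f t - g t) := by
  simpa [sub_eq_add_neg] using hf.add hg.neg

lemma LinB.I_mul (X : α → ℝ) (hX : ∀ t, |X t| ≤ N t) : LinB N (fun t => Complex.I * X t) :=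
  ⟨1, zero_le_one, fun t => by simp; linarith [hX t]⟩

lemma LinB.subExp (hN : ∀ t, 0 ≤ N t) (hf : LinB N f) : SubExp N f := by
  obtain ⟨K, hK, h1⟩ := hf
  intro ε hε
  obtain ⟨C, hC, h⟩ := exists_poly_exp 1 ε zero_le_one hε
  refine ⟨K * C + 1, by positivity, fun t => (h1 t).trans ?_⟩
  have := mul_le_mul_of_nonneg_left (h _ (hN t)) hK
  have h2 := Real.exp_pos (ε * N t)
  nlinarith

lemma SubExp.of_bdd (hN : ∀ t, 0 ≤ N t) {K : ℝ} (h : ∀ t, ‖f t‖ ≤ K) : SubExp N f := by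
  refine LinB.subExp hN ⟨|K|, abs_nonneg _, fun t => (h t).trans ?_⟩
  nlinarith [hN t, le_abs_self K, abs_nonneg K]

lemma SubExp.const (hN : ∀ t, 0 ≤ N t) (z : ℂ) : SubExp N (fun _ => z) :=
  SubExp.of_bdd hN (K := ‖z‖) (fun _ => le_rfl)

lemma SubExp.mul (hf : SubExp N f) (hg : SubExp N g) : SubExp N (fun t => f t * g t) := by
  intro ε hε
  obtain ⟨C, hC, h1⟩ := hf (ε / 2) (by positivity)
  obtain ⟨D, hD, h2⟩ := hg (ε / 2) (by positivity)
  refine ⟨C * D, by positivity, fun t => ?_⟩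
  rw [norm_mul]
  calc _ ≤ (C * Real.exp (ε / 2 * N t)) * (D * Real.exp (ε / 2 * N t)) := by
        gcongr; exacts [h1 t, h2 t]
    _ = C * D * (Real.exp (ε / 2 * N t) * Real.exp (ε / 2 * N t)) := by ring
    _ = _ := by rw [← Real.exp_add]; congr 2; ring

lemma SubExp.add (hf : SubExp N f) (hg : SubExp N g) : SubExp N (fun t => f t + g t) := by
  intro ε hε
  obtain ⟨C, hC, h1⟩ := hf ε hε
  obtain ⟨D, hD, h2⟩ := hg ε hε
  refine ⟨C + D, by positivity, fun t => (norm_add_le _ _).trans ?_⟩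
  linarith [h1 t, h2 t]

lemma SubExp.sum (hN : ∀ t, 0 ≤ N t) {ι : Type*} (S : Finset ι) (F : ι → α → ℂ)
    (h : ∀ i ∈ S, SubExp N (F i)) : SubExp N (fun t => ∑ i ∈ S, F i t) := by
  classical
  induction S using Finset.induction_on with
  | empty => simpa using SubExp.const hN 0
  | insert i S hi ih =>
    simp only [Finset.sum_insert hi]
    exact (h i (by simp)).add (ih fun j hj => h j (by simp [hj]))

lemma SubExp.prod (hN : ∀ t, 0 ≤ N t) {ι : Type*} (S : Finset ι) (F : ι → α → ℂ)
    (h : ∀ i ∈ S, SubExp N (F i)) : SubExp N (fun t => ∏ i ∈ S, F i t) := by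
  classical
  induction S using Finset.induction_on with
  | empty => simpa using SubExp.const hN 1
  | insert i S hi ih =>
    simp only [Finset.prod_insert hi]
    exact (h i (by simp)).mul (ih fun j hj => h j (by simp [hj]))

lemma SubExp.pochC (hN : ∀ t, 0 ≤ N t) (hf : LinB N f) (k : ℕ) :
    SubExp N (fun t => pochC (f t) k) := by
  unfold _root_.pochC
  exact SubExp.prod hN _ _ fun j _ => (hf.add (LinB.const hN _)).subExp hN

lemma SubExp.pochC_inv (hN : ∀ t, 0 ≤ N t) {δ : ℝ} (hδ : 0 < δ) (hf : ∀ t, δ ≤ (f t).re) (k : ℕ) :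
    SubExp N (fun t => (_root_.pochC (f t) k)⁻¹) := by
  unfold _root_.pochC
  simp only [← Finset.prod_inv_distrib]
  refine SubExp.prod hN _ _ fun j _ => SubExp.of_bdd hN (K := δ⁻¹) fun t => ?_
  rw [norm_inv]
  apply inv_anti₀ hδ
  refine le_trans ?_ (Complex.re_le_norm _)
  have : (0:ℝ) ≤ j := Nat.cast_nonneg j
  simp; linarith [hf t]

lemma SubExp.wilsonP (hN : ∀ t, 0 ≤ N t) {A B C D : α → ℂ} {X : α → ℝ}
    (hA : LinB N A) (hB : LinB N B) (hC : LinB N C) (hD : LinB N D) (hX : ∀ t, |X t| ≤ N t)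
    {δ : ℝ} (hδ : 0 < δ) (hAB : ∀ t, δ ≤ (A t + B t).re) (hAC : ∀ t, δ ≤ (A t + C t).re)
    (hAD : ∀ t, δ ≤ (A t + D t).re) (n : ℕ) :
    SubExp N (fun t => wilsonP (A t) (B t) (C t) (D t) n (X t)) := by
  unfold _root_.wilsonP
  refine (((SubExp.pochC hN (hA.add hB) n).mul (SubExp.pochC hN (hA.add hC) n)).mul
    (SubExp.pochC hN (hA.add hD) n)).mul (SubExp.sum hN _ _ fun k _ => ?_)
  simp only [div_eq_mul_inv, mul_inv]
  refine SubExp.mul (SubExp.mul (SubExp.mul (SubExp.mul (SubExp.const hN _) ?_) ?_) ?_)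
    (SubExp.mul (SubExp.mul (SubExp.mul (SubExp.const hN _) ?_) ?_) ?_)
  · exact SubExp.pochC hN (((((LinB.const hN _).add hA).add hB).add hC).add hD |>.sub (LinB.const hN _)) k
  · exact SubExp.pochC hN (hA.add (LinB.I_mul X hX)) k
  · exact SubExp.pochC hN (hA.sub (LinB.I_mul X hX)) k
  · exact SubExp.pochC_inv hN hδ hAB k
  · exact SubExp.pochC_inv hN hδ hAC k
  · exact SubExp.pochC_inv hN hδ hAD k

end growth

lemma pochC_cont {α : Type*} [TopologicalSpace α] {f : α → ℂ} (hf : Continuous f) (k : ℕ) :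
    Continuous (fun t => pochC (f t) k) := by
  unfold pochC
  fun_prop

lemma wilsonP_cont {α : Type*} [TopologicalSpace α] {A B C D : α → ℂ} {X : α → ℝ}
    (hA : Continuous A) (hB : Continuous B) (hC : Continuous C) (hD : Continuous D)
    (hX : Continuous X) (hAB : ∀ t, 0 < (A t + B t).re) (hAC : ∀ t, 0 < (A t + C t).re)
    (hAD : ∀ t, 0 < (A t + D t).re) (n : ℕ) :
    Continuous (fun t => wilsonP (A t) (B t) (C t) (D t) n (X t)) := by
  unfold wilsonP
  refine (((pochC_cont (hA.add hB) n).mul (pochC_cont (hA.add hC) n)).mul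
    (pochC_cont (hA.add hD) n)).mul (continuous_finsetSum _ fun k _ => ?_)
  have hX' : Continuous (fun t => Complex.I * (X t : ℂ)) := by fun_prop
  refine Continuous.div ?_ ?_ fun t => ?_
  · exact ((continuous_const.mul (pochC_cont (by fun_prop) k)).mul
      (pochC_cont (hA.add hX') k)).mul (pochC_cont (hA.sub hX') k)
  · exact ((continuous_const.mul (pochC_cont (hA.add hB) k)).mul
      (pochC_cont (hA.add hC) k)).mul (pochC_cont (hA.add hD) k)
  · have : (k.factorial : ℂ) ≠ 0 := by exact_mod_cast k.factorial_ne_zero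
    have h1 := pochC_ne_zero (hAB t) k
    have h2 := pochC_ne_zero (hAC t) k
    have h3 := pochC_ne_zero (hAD t) k
    positivity

lemma subExp_wt_integrable {f : ℝ → ℂ} (hf : Continuous f) (h : SubExp (fun x : ℝ => |x|) f)
    {a b c d : ℂ} (ha : 0 < a.re) (hb : 0 < b.re) (hc : 0 < c.re) (hd : 0 < d.re) :
    Integrable (fun x => f x * wt a b c d x) := by
  obtain ⟨C, hC, h1⟩ := h 1 one_pos
  obtain ⟨D, hD, h2⟩ := wt_bound ha hb hc hd
  refine integrable_of_exp_bound (C := C * D) (δ := 3) (hf.mul (wt_cont ha hb hc hd)) (by norm_num)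
    fun x => ?_
  rw [norm_mul]
  calc _ ≤ (C * Real.exp (1 * |x|)) * (D * Real.exp (-4 * |x|)) := by
        gcongr; exacts [h1 x, h2 x]
    _ = C * D * (Real.exp (1 * |x|) * Real.exp (-4 * |x|)) := by ring
    _ = _ := by rw [← Real.exp_add]; congr 2; ring

lemma wilsonP_cont1 {a b c d : ℂ} (ha : 0 < a.re) (hb : 0 < b.re) (hc : 0 < c.re)
    (hd : 0 < d.re) (n : ℕ) : Continuous (wilsonP a b c d n) :=
  wilsonP_cont (A := fun _ => a) (B := fun _ => b) (C := fun _ => c) (D := fun _ => d)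
    (X := fun x : ℝ => x) continuous_const continuous_const continuous_const continuous_const
    continuous_id (fun _ => by simp; linarith) (fun _ => by simp; linarith)
    (fun _ => by simp; linarith) n

lemma wilsonP_subExp1 {a b c d : ℂ} (ha : 0 < a.re) (hb : 0 < b.re) (hc : 0 < c.re)
    (hd : 0 < d.re) (n : ℕ) : SubExp (fun x : ℝ => |x|) (wilsonP a b c d n) :=
  have hN : ∀ t : ℝ, 0 ≤ |t| := abs_nonneg
  SubExp.wilsonP hN (LinB.const hN a) (LinB.const hN b) (LinB.const hN c) (LinB.const hN d)
    (X := fun x : ℝ => x) (fun _ => le_rfl) ha (fun _ => by simp; linarith)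
    (fun _ => by simp; linarith) (fun _ => by simp; linarith) n

/-! ### One-dimensional Wilson orthogonality -/

lemma wt_shift {a b c d : ℂ} (ha : 0 < a.re) (k : ℕ) (x : ℝ) :
    pochC (a + Complex.I * x) k * pochC (a - Complex.I * x) k * wt a b c d x = wt (a + k) b c d x := by
  have h1 : 0 < (a + Complex.I * x).re := by simpa using ha
  have h2 : 0 < (a - Complex.I * x).re := by simpa using ha
  unfold wt gP
  have e1 : a + k + Complex.I * x = a + Complex.I * x + k := by ring
  have e2 : a + k - Complex.I * x = a - Complex.I * x + k := by ring
  rw [e1, e2, gamma_pochC h1, gamma_pochC h2]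
  ring

lemma pochC_add (z : ℂ) (j k : ℕ) : pochC z (j + k) = pochC z j * pochC (z + j) k := by
  unfold pochC
  rw [Finset.prod_range_add]
  congr 1
  refine Finset.prod_congr rfl fun i _ => ?_
  push_cast; ring

lemma pochC_swap (z : ℂ) (j k : ℕ) : pochC z j * pochC (z + j) k = pochC z k * pochC (z + k) j := by
  rw [← pochC_add, ← pochC_add, add_comm]

lemma pochC_asc (z : ℂ) (n : ℕ) : (ascPochhammer ℂ n).eval z = pochC z n := by
  induction n with
  | zero => simp [pochC_zero]
  | succ n ih => rw [ascPochhammer_succ_eval, ih, pochC_succ]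

lemma pochC_neg (n k : ℕ) (hk : k ≤ n) :
    pochC (-(n:ℂ)) k = (-1) ^ k * (n.choose k) * k.factorial := by
  have h : ((n.choose k * k.factorial : ℕ) : ℂ) = ∏ i ∈ Finset.range k, ((n:ℂ) - i) := by
    rw [mul_comm, ← Nat.descFactorial_eq_factorial_mul_choose, Nat.descFactorial_eq_prod_range]
    push_cast
    refine Finset.prod_congr rfl fun i hi => ?_
    rw [Nat.cast_sub]
    have := Finset.mem_range.1 hi; omega
  push_cast at h
  rw [mul_assoc, h]
  unfold pochC
  rw [← Finset.card_range k, ← Finset.prod_const, Finset.card_range, ← Finset.prod_mul_distrib]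
  refine Finset.prod_congr rfl fun i hi => ?_
  ring

lemma pochC_reflect (z : ℂ) (n : ℕ) : pochC (1 - n - z) n = (-1) ^ n * pochC z n := by
  unfold pochC
  rw [← Finset.prod_range_reflect, ← Finset.card_range n, ← Finset.prod_const, Finset.card_range,
    ← Finset.prod_mul_distrib]
  refine Finset.prod_congr rfl fun i hi => ?_
  have := Finset.mem_range.1 hi
  rw [Nat.sub_sub, Nat.cast_sub (by omega)]
  push_cast
  ring

/-- alternating binomial sum -/
def altS (n : ℕ) (f : ℂ → ℂ) (y : ℂ) : ℂ :=
  ∑ k ∈ Finset.range (n + 1), (-1) ^ k * (n.choose k : ℂ) * f (y + k)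

lemma altS_eq (n : ℕ) (f : ℂ → ℂ) (y : ℂ) :
    altS n f y = (-1) ^ n * ((fwdDiff (1:ℂ))^[n] f y) := by
  rw [fwdDiff_iter_eq_sum_shift, Finset.mul_sum]
  refine Finset.sum_congr rfl fun k hk => ?_
  have hk' : k ≤ n := by have := Finset.mem_range.1 hk; omega
  obtain ⟨r, rfl⟩ := Nat.exists_eq_add_of_le hk'
  have h : ((-1:ℂ)) ^ r * (-1) ^ r = 1 := by rw [← mul_pow]; simp
  simp only [Nat.add_sub_cancel_left, zsmul_eq_mul, nsmul_eq_mul, mul_one]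
  push_cast
  rw [pow_add]
  linear_combination -(-1) ^ k * ((k + r).choose k : ℂ) * f (y + k) * h

lemma altS_poly (P : Polynomial ℂ) (n : ℕ) (h : P.natDegree < n) (y : ℂ) :
    altS n (fun z => P.eval z) y = 0 := by
  rw [altS_eq]
  have := Polynomial.fwdDiff_iter_eq_zero_of_degree_lt h
  rw [this]; simp

lemma altS_inv (n : ℕ) (u : ℂ) (hu : 0 < u.re) :
    altS n (fun z => z⁻¹) u = n.factorial / pochC u (n + 1) := by
  rw [altS_eq]
  induction n generalizing u with
  | zero => simp [pochC]
  | succ n ih =>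
    rw [Function.iterate_succ_apply', fwdDiff]
    have h1 := ih u hu
    have h2 := ih (u + 1) (by simp; linarith)
    have e1 : pochC u (n + 2) = u * pochC (u + 1) (n + 1) := by
      rw [show n + 2 = 1 + (n + 1) by ring, pochC_add]; simp [pochC]
    have e2 : pochC u (n + 2) = pochC u (n + 1) * (u + (n + 1 : ℕ)) := pochC_succ _ _
    have n1 := pochC_ne_zero hu (n + 1)
    have n2 := pochC_ne_zero (z := u + 1) (by simp; linarith) (n + 1)
    have n3 := pochC_ne_zero hu (n + 2)
    have n4 := nz_re hu
    have n5 := nz_re (re_add_nat_pos hu (n+1))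
    have q1 : (n.factorial : ℂ) / pochC u (n+1) = n.factorial * (u + (n + 1 : ℕ)) / pochC u (n+2) := by
      rw [e2]; field_simp
    have q2 : (n.factorial : ℂ) / pochC (u+1) (n+1) = n.factorial * u / pochC u (n+2) := by
      rw [e1]; field_simp
    rw [q1] at h1
    rw [q2] at h2
    rw [pow_succ]
    rw [Nat.factorial_succ]
    calc _ = (-1) ^ n * (fwdDiff 1)^[n] (fun z : ℂ => z⁻¹) u - (-1) ^ n * (fwdDiff 1)^[n] (fun z : ℂ => z⁻¹) (u + 1) := by ring
      _ = _ := by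
        rw [h1, h2]; push_cast; ring

/-! ### Two terminating summations and the orthogonality relation -/

lemma asc_comp_degree (n : ℕ) (z : ℂ) :
    ((ascPochhammer ℂ n).comp (Polynomial.X + Polynomial.C z)).natDegree = n := by
  rw [Polynomial.natDegree_comp, ascPochhammer_natDegree, Polynomial.natDegree_X_add_C, mul_one]

/-- the summand of the balanced terminating series -/
def saalT (n : ℕ) (z σ : ℂ) (j k : ℕ) : ℂ :=
  pochC (-(n:ℂ)) k * pochC ((n:ℂ) + σ - 1) k * pochC (z + j) k /
    ((k.factorial : ℂ) * pochC z k * pochC (σ + j) k)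

lemma saal_lt {n j : ℕ} (hj : j < n) {z σ : ℂ} (hz : 0 < z.re) (hσ : 0 < σ.re) :
    ∑ k ∈ Finset.range (n + 1), saalT n z σ j k = 0 := by
  obtain ⟨r, rfl⟩ : ∃ r, n = j + r + 1 := ⟨n - j - 1, by omega⟩
  have hσj := re_add_nat_pos hσ j
  set P : Polynomial ℂ := ((ascPochhammer ℂ j).comp (Polynomial.X + Polynomial.C z)) *
    ((ascPochhammer ℂ r).comp (Polynomial.X + Polynomial.C (σ + j))) with hP
  have hdeg : P.natDegree < j + r + 1 := by
    refine lt_of_le_of_lt Polynomial.natDegree_mul_le ?_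
    rw [asc_comp_degree, asc_comp_degree]; omega
  have h0 := altS_poly P _ hdeg 0
  have key : ∑ k ∈ Finset.range (j + r + 1 + 1), saalT (j + r + 1) z σ j k
      = (pochC z j * pochC (σ + j) r)⁻¹ * altS (j + r + 1) (fun z => P.eval z) 0 := by
    unfold altS
    rw [Finset.mul_sum]
    refine Finset.sum_congr rfl fun k hk => ?_
    have hk' : k ≤ j + r + 1 := by have := Finset.mem_range.1 hk; omega
    unfold saalT
    rw [pochC_neg _ _ hk']
    have e1 := pochC_swap z j k
    have e2 := pochC_swap (σ + j) r k
    have e3 : (((j + r + 1 : ℕ) : ℂ) + σ - 1) = σ + j + r := by push_cast; ring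
    rw [e3]
    have eP : P.eval (0 + (k:ℂ)) = pochC (z + k) j * pochC (σ + j + k) r := by
      rw [hP]
      simp only [Polynomial.eval_mul, Polynomial.eval_comp, pochC_asc, Polynomial.eval_add,
        Polynomial.eval_X, Polynomial.eval_C]
      congr 2 <;> ring
    simp only [eP]
    have n1 := pochC_ne_zero hz j
    have n2 := pochC_ne_zero hz k
    have n3 := pochC_ne_zero hσj r
    have n4 := pochC_ne_zero hσj k
    have n5 : (k.factorial : ℂ) ≠ 0 := by exact_mod_cast k.factorial_ne_zero
    have f1 : pochC (z + j) k = pochC z k * pochC (z + k) j / pochC z j := by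
      rw [← e1]; field_simp
    have f2 : pochC (σ + j + r) k = pochC (σ + j) k * pochC (σ + j + k) r / pochC (σ + j) r := by
      rw [← e2]; field_simp
    rw [f1, f2]
    field_simp
  rw [key, h0, mul_zero]

lemma saal_eq (n : ℕ) {z σ : ℂ} (hz : 0 < z.re) (hσ : 0 < σ.re) :
    ∑ k ∈ Finset.range (n + 1), saalT n z σ n k =
      (-1) ^ n * n.factorial * pochC (σ - z) n / (pochC z n * pochC (σ + n) n) := by
  rcases Nat.eq_zero_or_pos n with rfl | hn
  · simp [saalT, pochC_zero]
  obtain ⟨r, rfl⟩ : ∃ r, n = r + 1 := ⟨n - 1, by omega⟩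
  set n := r + 1 with hnr
  set u : ℂ := σ + r with hu
  have hur : 0 < u.re := re_add_nat_pos hσ r
  have hu1 : σ + n = u + 1 := by rw [hu, hnr]; push_cast; ring
  set P : Polynomial ℂ := (ascPochhammer ℂ n).comp (Polynomial.X + Polynomial.C (z - u)) with hP
  have hdeg : P.divX.natDegree < n := by
    rw [Polynomial.natDegree_divX_eq_natDegree_tsub_one, asc_comp_degree]; omega
  have h0 := altS_poly P.divX _ hdeg u
  have h1 := altS_inv n u hur
  have hc : P.coeff 0 = (-1) ^ n * pochC (σ - z) n := by
    rw [Polynomial.coeff_zero_eq_eval_zero, ← pochC_reflect, hP]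
    simp only [Polynomial.eval_comp, pochC_asc, Polynomial.eval_add, Polynomial.eval_X, Polynomial.eval_C]
    congr 1
    rw [hu, hnr]; push_cast; ring
  have key : ∑ k ∈ Finset.range (n + 1), saalT n z σ n k
      = u / pochC z n * (P.coeff 0 * altS n (fun z => z⁻¹) u + altS n (fun z => P.divX.eval z) u) := by
    unfold altS
    rw [Finset.mul_sum, ← Finset.sum_add_distrib, Finset.mul_sum]
    refine Finset.sum_congr rfl fun k hk => ?_
    have hk' : k ≤ n := by have := Finset.mem_range.1 hk; omega
    have huk := nz_re (re_add_nat_pos hur k)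
    have eP : P.eval (u + k) = pochC (z + k) n := by
      rw [hP]
      simp only [Polynomial.eval_comp, pochC_asc, Polynomial.eval_add,
        Polynomial.eval_X, Polynomial.eval_C]
      congr 1; ring
    have eQ : P.eval (u + k) = P.divX.eval (u + k) * (u + k) + P.coeff 0 := by
      conv_lhs => rw [← Polynomial.divX_mul_X_add P]
      simp
    have e4 : P.coeff 0 * (u + (k:ℂ))⁻¹ + P.divX.eval (u + k) = pochC (z + k) n / (u + k) := by
      rw [← eP, eQ]; field_simp; ring
    have e1 := pochC_swap z n k
    have e3 : ((n : ℂ) + σ - 1) = u := by rw [hu, hnr]; push_cast; ring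
    have e2 : u * pochC (u + 1) k = pochC u k * (u + k) := by
      have := pochC_swap u 1 k
      simpa [pochC] using this
    unfold saalT
    rw [pochC_neg _ _ hk', e3, hu1]
    have n1 := pochC_ne_zero hz n
    have n2 := pochC_ne_zero hz k
    have n4 := pochC_ne_zero (z := u + 1) (by simp; linarith) k
    have n5 : (k.factorial : ℂ) ≠ 0 := by exact_mod_cast k.factorial_ne_zero
    have f1 : pochC (z + n) k = pochC z k * pochC (z + k) n / pochC z n := by
      rw [← e1]; field_simp
    have f2 : pochC u k = u * pochC (u + 1) k / (u + k) := by
      rw [e2]; field_simp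
    calc _ = (-1) ^ k * (n.choose k : ℂ) * (u / pochC z n * (pochC (z + k) n / (u + k))) := by
          rw [f1, f2]; field_simp
      _ = _ := by rw [← e4]; ring
  rw [key, h0, h1, hc, hu1]
  have e5 : pochC u (n + 1) = u * pochC (u + 1) n := by
    rw [add_comm n 1, pochC_add]; simp [pochC]
  have n1 := pochC_ne_zero hz n
  have n2 := pochC_ne_zero (z := u + 1) (by simp; linarith) n
  have n3 := nz_re hur
  rw [e5]
  field_simp
  ring

section orth
variable {a b c d : ℂ}

/-- the coefficients of the Wilson polynomial -/
def wco (a b c d : ℂ) (n k : ℕ) : ℂ :=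
  pochC (a + b) n * pochC (a + c) n * pochC (a + d) n *
    (pochC (-(n : ℂ)) k * pochC ((n : ℂ) + a + b + c + d - 1) k /
      ((k.factorial : ℂ) * pochC (a + b) k * pochC (a + c) k * pochC (a + d) k))

lemma wilsonP_eq (a b c d : ℂ) (n : ℕ) (x : ℝ) :
    wilsonP a b c d n x = ∑ k ∈ Finset.range (n + 1), wco a b c d n k *
      (pochC (a + Complex.I * x) k * pochC (a - Complex.I * x) k) := by
  unfold wilsonP wco
  rw [Finset.mul_sum]
  refine Finset.sum_congr rfl fun k _ => ?_
  ring

/-- moments of the Wilson polynomial -/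
def wQ (a b c d : ℂ) (n k j : ℕ) : ℂ := ∫ x, wilsonP a b c d n x * wt (a + k) (b + j) c d x

lemma wQ_int (ha : 0 < a.re) (hb : 0 < b.re) (hc : 0 < c.re) (hd : 0 < d.re) (n k j : ℕ) :
    Integrable (fun x => wilsonP a b c d n x * wt (a + k) (b + j) c d x) :=
  subExp_wt_integrable (wilsonP_cont1 ha hb hc hd n) (wilsonP_subExp1 ha hb hc hd n)
    (re_add_nat_pos ha k) (re_add_nat_pos hb j) hc hd

lemma wQ_rec (ha : 0 < a.re) (hb : 0 < b.re) (hc : 0 < c.re) (hd : 0 < d.re) (n k j : ℕ) :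
    wQ a b c d n (k + 1) j = wQ a b c d n k (j + 1) +
      ((a + k) ^ 2 - (b + j) ^ 2) * wQ a b c d n k j := by
  unfold wQ
  rw [← integral_const_mul, ← integral_add (wQ_int ha hb hc hd n k (j+1))
    ((wQ_int ha hb hc hd n k j).const_mul _)]
  congr 1
  funext x
  have h1 := gP_add_one (re_add_nat_pos ha k) x
  have h2 := gP_add_one (re_add_nat_pos hb j) x
  have e1 : a + ((k + 1 : ℕ) : ℂ) = a + k + 1 := by push_cast; ring
  have e2 : b + ((j + 1 : ℕ) : ℂ) = b + j + 1 := by push_cast; ring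
  unfold wt
  rw [e1, e2, h1, h2]
  ring

lemma wQ_alg (π4 g1 g2 g3 g4 g5 g6 g7 p1 p2 p3 p4 p5 p6 p7 q1 q2 q3 f : ℂ) 
    (n2 : p2 ≠ 0) (n3 : p3 ≠ 0) :
    q1 * q2 * q3 * (p6 * p7 / (f * p1 * p2 * p3)) *
      (π4 * (p5 * g2 * (p2 * g3) * (p3 * g4) * g5 * g6 * g7) / (p4 * g1)) =
    q1 * q2 * q3 * (π4 * (g2 * g3 * g4 * g5 * g6 * g7) / g1) * (p6 * p7 * p5 / (f * p1 * p4)) := by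
  have e : (p2 * p3) * (p2 * p3)⁻¹ = 1 := mul_inv_cancel₀ (mul_ne_zero n2 n3)
  simp only [div_eq_mul_inv, mul_inv] at e ⊢
  generalize p1⁻¹ = i1
  generalize p2⁻¹ = i2 at *
  generalize p3⁻¹ = i3 at *
  generalize p4⁻¹ = i4
  generalize f⁻¹ = i5
  generalize g1⁻¹ = i6
  linear_combination (q1 * q2 * q3 * p6 * p7 * i5 * i1 * π4 * p5 * g2 * g3 * g4 * g5 * g6 * g7 * i4 * i6) * e

lemma wQ_term (ha : 0 < a.re) (hb : 0 < b.re) (hc : 0 < c.re) (hd : 0 < d.re) (n j k : ℕ) :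
    wco a b c d n k * ∫ x, wt (a + k) (b + j) c d x =
      pochC (a + b) n * pochC (a + c) n * pochC (a + d) n *
      (4 * Real.pi * (Gamma (a + b + j) * Gamma (a + c) * Gamma (a + d) * Gamma (b + c + j) *
        Gamma (b + d + j) * Gamma (c + d)) / Gamma (a + b + c + d + j)) *
      saalT n (a + b) (a + b + c + d) j k := by
  have hbj := re_add_nat_pos hb j
  have hab : 0 < (a + b).re := by simp; linarith
  have hac : 0 < (a + c).re := by simp; linarith
  have had : 0 < (a + d).re := by simp; linarith
  have hσ : 0 < (a + b + c + d).re := by simp; linarith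
  rw [wilson_integral (re_add_nat_pos ha k) hbj hc hd]
  have habj := re_add_nat_pos hab j
  have hσj := re_add_nat_pos hσ j
  rw [show a + k + (b + j) = a + b + j + k by ring, show a + k + c = a + c + k by ring,
    show a + k + d = a + d + k by ring, show b + j + c = b + c + j by ring,
    show b + j + d = b + d + j by ring, show a + b + j + k + c + d = a + b + c + d + j + k by ring,
    gamma_pochC habj, gamma_pochC hac, gamma_pochC had, gamma_pochC hσj]
  unfold wco saalT
  rw [show (n:ℂ) + (a + b + c + d) - 1 = n + a + b + c + d - 1 by ring]
  have n1 := pochC_ne_zero hab k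
  have n2 := pochC_ne_zero hac k
  have n3 := pochC_ne_zero had k
  exact wQ_alg _ _ _ _ _ _ _ _ _ _ _ _ _ _ _ _ _ _ _ n2 n3

lemma wQ_zero (ha : 0 < a.re) (hb : 0 < b.re) (hc : 0 < c.re) (hd : 0 < d.re) (n j : ℕ) :
    wQ a b c d n 0 j = pochC (a + b) n * pochC (a + c) n * pochC (a + d) n *
      (4 * Real.pi * (Gamma (a + b + j) * Gamma (a + c) * Gamma (a + d) * Gamma (b + c + j) *
        Gamma (b + d + j) * Gamma (c + d)) / Gamma (a + b + c + d + j)) *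
      ∑ k ∈ Finset.range (n + 1), saalT n (a + b) (a + b + c + d) j k := by
  have hbj := re_add_nat_pos hb j
  have hab : 0 < (a + b).re := by simp; linarith
  have hac : 0 < (a + c).re := by simp; linarith
  have had : 0 < (a + d).re := by simp; linarith
  have hσ : 0 < (a + b + c + d).re := by simp; linarith
  have h1 : ∀ x, wilsonP a b c d n x * wt (a + (0:ℕ)) (b + j) c d x =
      ∑ k ∈ Finset.range (n + 1), wco a b c d n k * wt (a + k) (b + j) c d x := by
    intro x
    rw [wilsonP_eq, Finset.sum_mul]
    refine Finset.sum_congr rfl fun k _ => ?_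
    rw [← wt_shift ha k x]
    simp only [Nat.cast_zero, add_zero]
    ring
  have h2 : wQ a b c d n 0 j = ∑ k ∈ Finset.range (n + 1), wco a b c d n k *
      ∫ x, wt (a + k) (b + j) c d x := by
    unfold wQ
    rw [integral_congr_ae (Filter.Eventually.of_forall h1), integral_finsetSum _ fun k _ =>
      (wt_integrable (re_add_nat_pos ha k) hbj hc hd).const_mul _]
    simp only [integral_const_mul]
  rw [h2, Finset.mul_sum]
  exact Finset.sum_congr rfl fun k _ => wQ_term ha hb hc hd n j k

lemma wQ_lt (ha : 0 < a.re) (hb : 0 < b.re) (hc : 0 < c.re) (hd : 0 < d.re) (n k j : ℕ)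
    (h : k + j < n) : wQ a b c d n k j = 0 := by
  induction k generalizing j with
  | zero =>
    rw [wQ_zero ha hb hc hd, saal_lt (by omega) (by simp; linarith) (by simp; linarith), mul_zero]
  | succ k ih =>
    rw [wQ_rec ha hb hc hd, ih _ (by omega), ih _ (by omega)]; simp

lemma wQ_eq (ha : 0 < a.re) (hb : 0 < b.re) (hc : 0 < c.re) (hd : 0 < d.re) (n k j : ℕ)
    (h : k + j = n) : wQ a b c d n k j = wQ a b c d n 0 n := by
  induction k generalizing j with
  | zero =>
    have : j = n := by omega
    rw [this]
  | succ k ih =>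
    rw [wQ_rec ha hb hc hd, ih _ (by omega), wQ_lt ha hb hc hd n k j (by omega)]; simp

/-- the squared norm of the Wilson polynomial -/
def wnorm (a b c d : ℂ) (n : ℕ) : ℂ :=
  4 * Real.pi * (n.factorial * pochC ((n:ℂ) + a + b + c + d - 1) n) *
    (Gamma (a + b + n) * Gamma (a + c + n) * Gamma (a + d + n) * Gamma (b + c + n) *
      Gamma (b + d + n) * Gamma (c + d + n)) / Gamma (a + b + c + d + 2 * n)

lemma wQ_diag (ha : 0 < a.re) (hb : 0 < b.re) (hc : 0 < c.re) (hd : 0 < d.re) (n : ℕ) :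
    wQ a b c d n 0 n = (-1) ^ n * (4 * Real.pi * n.factorial *
    (Gamma (a + b + n) * Gamma (a + c + n) * Gamma (a + d + n) * Gamma (b + c + n) *
      Gamma (b + d + n) * Gamma (c + d + n)) / Gamma (a + b + c + d + 2 * n)) := by
  have hab : 0 < (a + b).re := by simp; linarith
  have hac : 0 < (a + c).re := by simp; linarith
  have had : 0 < (a + d).re := by simp; linarith
  have hcd : 0 < (c + d).re := by simp; linarith
  have hσ : 0 < (a + b + c + d).re := by simp; linarith
  have hσn := re_add_nat_pos hσ n
  rw [wQ_zero ha hb hc hd, saal_eq n hab hσ, show a + b + c + d - (a + b) = c + d by ring,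
    show a + b + c + d + 2 * n = a + b + c + d + n + n by ring, gamma_pochC hσn, gamma_pochC hcd,
    gamma_pochC hac, gamma_pochC had]
  have n1 := pochC_ne_zero hab n
  have n4 := pochC_ne_zero hσn n
  have n6 := gamma_nz hσn
  field_simp

lemma orth_alg (p q r e f g k l π4 : ℂ) (n1 : p ≠ 0) (n2 : q ≠ 0) (n3 : r ≠ 0) (n4 : f ≠ 0)
    (h : e * e = 1) :
    p * q * r * (e * f * g / (f * p * q * r)) * (e * (π4 * f * k / l)) = π4 * (f * g) * k / l := by
  have : p * q * r * (e * f * g / (f * p * q * r)) = e * g := by field_simp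
  rw [this]
  linear_combination (π4 * (f * g) * k / l) * h

lemma wilson_orth_le (ha : 0 < a.re) (hb : 0 < b.re) (hc : 0 < c.re) (hd : 0 < d.re) (n m : ℕ)
    (hm : m ≤ n) :
    ∫ x, wilsonP a b c d n x * wilsonP a b c d m x * wt a b c d x =
      if n = m then wnorm a b c d n else 0 := by
  have h1 : ∀ x, wilsonP a b c d n x * wilsonP a b c d m x * wt a b c d x =
      ∑ k ∈ Finset.range (m + 1), wco a b c d m k *
        (wilsonP a b c d n x * wt (a + k) (b + (0:ℕ)) c d x) := by
    intro x
    rw [wilsonP_eq a b c d m, Finset.mul_sum, Finset.sum_mul]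
    refine Finset.sum_congr rfl fun k _ => ?_
    rw [← wt_shift ha k x]
    simp only [Nat.cast_zero, add_zero]
    ring
  simp only [h1]
  rw [integral_finsetSum _ fun k _ => (wQ_int ha hb hc hd n k 0).const_mul _]
  simp only [integral_const_mul]
  have h2 : ∀ k : ℕ, ∫ x, wilsonP a b c d n x * wt (a + k) (b + (0:ℕ)) c d x = wQ a b c d n k 0 :=
    fun k => rfl
  simp only [h2]
  rcases hm.eq_or_lt with rfl | hlt
  · rw [if_pos rfl, Finset.sum_range_succ, Finset.sum_eq_zero, zero_add,
      wQ_eq ha hb hc hd _ _ _ (by simp), wQ_diag ha hb hc hd]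
    · unfold wco wnorm
      rw [pochC_neg _ _ le_rfl]
      have n1 := pochC_ne_zero (z := a + b) (by simp; linarith) m
      have n2 := pochC_ne_zero (z := a + c) (by simp; linarith) m
      have n3 := pochC_ne_zero (z := a + d) (by simp; linarith) m
      have n5 : (m.factorial : ℂ) ≠ 0 := by exact_mod_cast m.factorial_ne_zero
      have h : ((-1:ℂ)) ^ m * (-1) ^ m = 1 := by rw [← mul_pow]; simp
      rw [Nat.choose_self, Nat.cast_one, mul_one]
      exact orth_alg _ _ _ _ _ _ _ _ _ n1 n2 n3 n5 h
    · intro k hk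
      rw [wQ_lt ha hb hc hd _ _ _ (by have := Finset.mem_range.1 hk; omega), mul_zero]
  · rw [if_neg (by omega)]
    refine Finset.sum_eq_zero fun k hk => ?_
    rw [wQ_lt ha hb hc hd _ _ _ (by have := Finset.mem_range.1 hk; omega), mul_zero]

lemma wilson_orth (ha : 0 < a.re) (hb : 0 < b.re) (hc : 0 < c.re) (hd : 0 < d.re) (n m : ℕ) :
    ∫ x, wilsonP a b c d n x * wilsonP a b c d m x * wt a b c d x =
      if n = m then wnorm a b c d n else 0 := by
  rcases le_total m n with h | h
  · exact wilson_orth_le ha hb hc hd n m h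
  · have := wilson_orth_le ha hb hc hd m n h
    simp only [mul_comm (wilsonP a b c d m _)] at this
    rw [this]
    by_cases e : n = m
    · subst e; rfl
    · rw [if_neg e, if_neg (Ne.symm e)]

end orth

/-! ### Recursions in the number of variables -/

/-- the parameters without the last one -/
def eA (a b : ℂ) (ap : ℕ → ℂ) (i : ℕ) : ℂ := if i = 1 then (a + b) / 2 else ap i

section recs
variable {a b c d : ℂ} {ap : ℕ → ℂ}

lemma apEx_le (c d : ℂ) {s k : ℕ} (hk : k ≤ s) : apEx a b c d ap s k = eA a b ap k := by
  unfold apEx eA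
  rw [if_neg (show ¬ k = s + 1 by omega)]

lemma apEx_last (c d : ℂ) {s : ℕ} (hs : 1 ≤ s) : apEx a b c d ap s (s + 1) = (c + d) / 2 := by
  unfold apEx
  rw [if_neg (by omega), if_pos rfl]

lemma alphaS_self (c d : ℂ) (s j : ℕ) :
    alphaS a b c d ap s j s = ∑ i ∈ Finset.Icc j s, eA a b ap i := by
  unfold alphaS
  exact Finset.sum_congr rfl fun i hi => apEx_le c d (Finset.mem_Icc.1 hi).2

lemma alphaS_succ (c d : ℂ) {s j : ℕ} (hs : 1 ≤ s) (hj : j ≤ s + 1) :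
    alphaS a b c d ap s j (s + 1) = ∑ i ∈ Finset.Icc j s, eA a b ap i + (c + d) / 2 := by
  unfold alphaS
  rw [Finset.sum_Icc_succ_top hj, apEx_last c d hs]
  congr 1
  exact Finset.sum_congr rfl fun i hi => apEx_le c d (Finset.mem_Icc.1 hi).2

lemma psum_succ (n : ℕ → ℕ) {s j : ℕ} (hj : j ≤ s + 1) : psum n j (s + 1) = psum n j s + n (s + 1) := by
  unfold psum
  rw [Finset.sum_Icc_succ_top hj]

lemma psum_empty (n : ℕ → ℕ) {s j : ℕ} (hj : s < j) : psum n j s = 0 := by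
  unfold psum
  rw [Finset.Icc_eq_empty (by omega), Finset.sum_empty]

lemma sumA_succ {s j : ℕ} (hs : 1 ≤ s) (hj : j ≤ s + 1) : ∑ i ∈ Finset.Icc j (s + 1), eA a b ap i =
    ∑ i ∈ Finset.Icc j s, eA a b ap i + ap (s + 1) := by
  rw [Finset.sum_Icc_succ_top hj]
  congr 1
  unfold eA
  rw [if_neg (by omega)]

/-- shifted parameter -/
def shf (ap : ℕ → ℂ) (s : ℕ) (n : ℕ → ℕ) (c : ℂ) : ℂ := c + ap (s + 1) + n (s + 1)

lemma mv_succ (n : ℕ → ℕ) {s : ℕ} (hs : 1 ≤ s) (x : ℕ → ℝ) :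
    mvWilson2 a b c d ap (s + 1) n x =
      mvWilson2 a b (shf ap s n c) (shf ap s n d) ap s n x *
        wilsonP c d (ap (s + 1) + Complex.I * x s) (ap (s + 1) - Complex.I * x s) (n (s + 1))
          (x (s + 1)) := by
  have key : ∀ e : ℂ, ∀ j, j ≤ s + 1 → e + alphaS a b c d ap (s + 1) j (s + 1) + psum n j (s + 1) =
      shf ap s n e + alphaS a b (shf ap s n c) (shf ap s n d) ap s j s + psum n j s := by
    intro e j hj
    rw [alphaS_self, alphaS_self, sumA_succ hs hj, psum_succ n hj]
    unfold shf
    push_cast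
    ring
  unfold mvWilson2
  rw [Finset.prod_Icc_succ_top (by omega), key c 2 (by omega), key d 2 (by omega), ← mul_assoc]
  congr 1
  · congr 1
    refine Finset.prod_congr rfl fun k hk => ?_
    have := Finset.mem_Icc.1 hk
    rw [key c (k + 1) (by omega), key d (k + 1) (by omega)]
  · rw [alphaS_self, psum_empty n (by omega), Finset.Icc_eq_empty (by omega)]
    simp

/-- the link factor of the weight -/
def link (p : ℂ) (y x : ℝ) : ℂ := gP (p + Complex.I * y) x * gP (p - Complex.I * y) x * kW y

/-- the part of the weight without the end factor -/
def core (a b : ℂ) (ap : ℕ → ℂ) (s : ℕ) (x : ℕ → ℝ) : ℂ :=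
  gP a (x 1) * gP b (x 1) * ∏ k ∈ Finset.Icc 1 (s - 1), link (ap (k + 1)) (x k) (x (k + 1))

lemma rho_core (s : ℕ) (x : ℕ → ℝ) :
    wilsonRho a b c d ap s x = core a b ap s x * (gP c (x s) * gP d (x s) * kW (x s)) := by
  unfold wilsonRho core
  congr 1
  · congr 1
    · unfold gP; ring
    · refine Finset.prod_congr rfl fun k _ => ?_
      unfold link gP kW
      rw [div_eq_mul_inv]
      congr 1
      rw [show ap (k+1) + Complex.I * x k + Complex.I * x (k+1) =
            ap (k+1) + Complex.I * x (k+1) + Complex.I * x k by ring,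
        show ap (k+1) + Complex.I * x k - Complex.I * x (k+1) =
            ap (k+1) - Complex.I * x (k+1) + Complex.I * x k by ring,
        show ap (k+1) - Complex.I * x k + Complex.I * x (k+1) =
            ap (k+1) + Complex.I * x (k+1) - Complex.I * x k by ring,
        show ap (k+1) - Complex.I * x k - Complex.I * x (k+1) =
            ap (k+1) - Complex.I * x (k+1) - Complex.I * x k by ring]
      ring
  · unfold gP kW
    rw [div_eq_mul_inv]; ring

lemma core_succ {s : ℕ} (hs : 1 ≤ s) (x : ℕ → ℝ) :
    core a b ap (s + 1) x = core a b ap s x * link (ap (s + 1)) (x s) (x (s + 1)) := by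
  obtain ⟨t, rfl⟩ : ∃ t, s = t + 1 := ⟨s - 1, by omega⟩
  unfold core
  rw [Nat.add_sub_cancel, Nat.add_sub_cancel, Finset.prod_Icc_succ_top (by omega), ← mul_assoc]

lemma rho_succ {s : ℕ} (hs : 1 ≤ s) (x : ℕ → ℝ) :
    wilsonRho a b c d ap (s + 1) x = core a b ap s x * kW (x s) *
      wt c d (ap (s + 1) + Complex.I * x s) (ap (s + 1) - Complex.I * x s) (x (s + 1)) := by
  rw [rho_core, core_succ hs]
  unfold link wt
  ring

lemma core_congr {s : ℕ} (hs : 1 ≤ s) {x y : ℕ → ℝ} (h : ∀ k ∈ Finset.Icc 1 s, x k = y k) :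
    core a b ap s x = core a b ap s y := by
  unfold core
  rw [h 1 (by simp; omega)]
  congr 1
  refine Finset.prod_congr rfl fun k hk => ?_
  have := Finset.mem_Icc.1 hk
  rw [h k (by simp; omega), h (k + 1) (by simp; omega)]

lemma mv_congr {s : ℕ} (hs : 1 ≤ s) (n : ℕ → ℕ) {x y : ℕ → ℝ} (h : ∀ k ∈ Finset.Icc 1 s, x k = y k) :
    mvWilson2 a b c d ap s n x = mvWilson2 a b c d ap s n y := by
  unfold mvWilson2
  rw [h 1 (by simp; omega)]
  congr 1
  refine Finset.prod_congr rfl fun k hk => ?_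
  have := Finset.mem_Icc.1 hk
  rw [h k (by simp; omega), h (k - 1) (by simp; omega)]

/-- one-step normalization factor -/
def kap (c d p : ℂ) (n : ℕ) : ℂ :=
  4 * Real.pi * (n.factorial * pochC ((n:ℂ) + c + d + 2 * p - 1) n * Gamma (n + c + d) *
    Gamma (n + 2 * p) / Gamma (2 * n + 2 * p + c + d))

lemma wnorm_link (c d p : ℂ) (n : ℕ) (y : ℝ) :
    wnorm c d (p + Complex.I * y) (p - Complex.I * y) n =
      kap c d p n * (gP (c + p + n) y * gP (d + p + n) y) := by
  unfold wnorm kap gP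
  rw [show (n:ℂ) + c + d + (p + Complex.I * y) + (p - Complex.I * y) - 1 = n + c + d + 2 * p - 1 by ring,
    show c + d + n = n + c + d by ring,
    show c + (p + Complex.I * y) + n = c + p + n + Complex.I * y by ring,
    show c + (p - Complex.I * y) + n = c + p + n - Complex.I * y by ring,
    show d + (p + Complex.I * y) + n = d + p + n + Complex.I * y by ring,
    show d + (p - Complex.I * y) + n = d + p + n - Complex.I * y by ring,
    show p + Complex.I * y + (p - Complex.I * y) + n = n + 2 * p by ring,
    show c + d + (p + Complex.I * y) + (p - Complex.I * y) + 2 * n = 2 * n + 2 * p + c + d by ring]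
  ring

lemma lam_succ (n : ℕ → ℕ) {s : ℕ} (hs : 1 ≤ s) :
    lamW2 a b c d ap (s + 1) n =
      kap c d (ap (s + 1)) (n (s + 1)) * lamW2 a b (shf ap s n c) (shf ap s n d) ap s n := by
  have hA : ∀ j, j ≤ s + 1 → 2 * alphaS a b c d ap (s + 1) j (s + 2) + 2 * n (s + 1) =
      2 * alphaS a b (shf ap s n c) (shf ap s n d) ap s j (s + 1) := by
    intro j hj
    rw [alphaS_succ c d (by omega) (by omega), alphaS_succ _ _ hs hj, sumA_succ hs hj]
    unfold shf
    ring
  have key : ∀ e f : ℂ, e + f + alphaS a b c d ap (s + 1) 2 (s + 1) + psum n 1 (s + 1) =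
      e + shf ap s n f + alphaS a b (shf ap s n c) (shf ap s n d) ap s 2 s + psum n 1 s := by
    intro e f
    rw [alphaS_self, alphaS_self, sumA_succ hs (by omega), psum_succ n (by omega)]
    unfold shf
    push_cast
    ring
  unfold lamW2
  rw [Finset.prod_Icc_succ_top (by omega), key a c, key a d, key b c, key b d, pow_succ]
  rw [show ∀ P p Q q G : ℂ, P * p * (Q * q) * G = p * q * (P * Q * G) by intros P p Q q G; ring]
  congr 1
  · rw [psum_succ n (le_refl _), psum_empty n (show s < s + 1 by omega),
      psum_empty n (show s + 1 < s + 1 + 1 by omega), apEx_le c d le_rfl,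
      alphaS_succ c d (by omega) (by omega), alphaS_succ c d (by omega) (by omega),
      Finset.Icc_self, Finset.sum_singleton, Finset.Icc_eq_empty (show ¬ s + 1 + 1 ≤ s + 1 by omega)]
    unfold eA kap
    rw [if_neg (by omega)]
    simp only [Finset.sum_empty, Nat.cast_zero, zero_add, add_zero]
    rw [show (n (s+1) : ℂ) + 2 * (ap (s+1) + (c + d) / 2) - 1 = n (s+1) + c + d + 2 * ap (s+1) - 1 by ring,
      show (n (s+1) : ℂ) + 2 * ((c + d) / 2) = n (s+1) + c + d by ring,
      show 2 * (n (s+1) : ℂ) + 2 * (ap (s+1) + (c + d) / 2) = 2 * n (s+1) + 2 * ap (s+1) + c + d by ring]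
    push_cast
    ring
  · congr 1
    congr 1
    refine Finset.prod_congr rfl fun k hk => ?_
    have hk := Finset.mem_Icc.1 hk
    rw [apEx_le c d (by omega), apEx_le _ _ hk.2, psum_succ n (show k ≤ s + 1 by omega),
      psum_succ n (show k + 1 ≤ s + 1 by omega), ← hA k (by omega), ← hA (k + 1) (by omega)]
    push_cast
    congr 1
    · congr 1
      congr 1
      · congr 2
        ring
      · congr 1
        ring
    · congr 1
      ring

/-! the one-variable case -/

lemma mv_one (n : ℕ → ℕ) (x : ℕ → ℝ) :
    mvWilson2 a b c d ap 1 n x = wilsonP c d a b (n 1) (x 1) := by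
  unfold mvWilson2
  rw [alphaS_self, psum_empty n (by omega), Finset.Icc_eq_empty (by omega)]
  simp

lemma rho_one (x : ℕ → ℝ) : wilsonRho a b c d ap 1 x = wt c d a b (x 1) := by
  rw [rho_core]
  unfold core wt
  rw [Finset.Icc_eq_empty (by omega), Finset.prod_empty]
  ring

lemma lam_one (n : ℕ → ℕ) : lamW2 a b c d ap 1 n = wnorm c d a b (n 1) := by
  unfold lamW2
  rw [Finset.Icc_self, Finset.prod_singleton, alphaS_succ c d le_rfl (by omega), alphaS_succ c d le_rfl le_rfl,
    alphaS_self, psum_empty n (show 1 < 1 + 1 by omega), apEx_le c d le_rfl,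
    Finset.Icc_self, Finset.sum_singleton, Finset.Icc_eq_empty (show ¬ 1 + 1 ≤ 1 by omega)]
  unfold eA wnorm psum
  simp only [Finset.sum_empty, Nat.cast_zero, zero_add, add_zero, if_true, Finset.Icc_self,
    Finset.sum_singleton]
  rw [show (n 1 : ℂ) + 2 * ((a + b) / 2 + (c + d) / 2) - 1 = n 1 + c + d + a + b - 1 by ring,
    show (n 1 : ℂ) + 2 * ((c + d) / 2) = c + d + n 1 by ring,
    show (n 1 : ℂ) + 2 * ((a + b) / 2) = a + b + n 1 by ring,
    show 2 * (n 1 : ℂ) + 2 * ((a + b) / 2 + (c + d) / 2) = c + d + a + b + 2 * n 1 by ring,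
    add_comm a c, add_comm a d, add_comm b c, add_comm b d]
  push_cast
  ring

end recs

/-! ### Growth and integrability in several variables -/

/-- the `ℓ¹` gauge on the first `s` variables -/
def gN (s : ℕ) (x : ℕ → ℝ) : ℝ := ∑ k ∈ Finset.Icc 1 s, |x k|

lemma gN_nonneg (s : ℕ) (x : ℕ → ℝ) : 0 ≤ gN s x := Finset.sum_nonneg fun _ _ => abs_nonneg _

lemma gN_le {s k : ℕ} (hk : k ∈ Finset.Icc 1 s) (x : ℕ → ℝ) : |x k| ≤ gN s x :=
  Finset.single_le_sum (f := fun k => |x k|) (fun _ _ => abs_nonneg _) hk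

lemma gN_succ (s : ℕ) (x : ℕ → ℝ) : gN (s + 1) x = gN s x + |x (s + 1)| := by
  unfold gN; rw [Finset.sum_Icc_succ_top (by omega)]

section bounds
variable {a b c d : ℂ} {ap : ℕ → ℂ}

lemma tail_re {s k : ℕ} (hk : 1 ≤ k) (hap : ∀ k, 2 ≤ k → k ≤ s → 0 < (ap k).re) (n : ℕ → ℕ)
    (c d : ℂ) {e : ℂ} (he : 0 < e.re) :
    0 < (e + alphaS a b c d ap s (k + 1) s + psum n (k + 1) s).re := by
  apply re_add_nat_pos
  rw [alphaS_self, Complex.add_re, Complex.re_sum]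
  have : 0 ≤ ∑ i ∈ Finset.Icc (k + 1) s, (eA a b ap i).re := by
    refine Finset.sum_nonneg fun i hi => ?_
    have hi := Finset.mem_Icc.1 hi
    unfold eA
    rw [if_neg (by omega)]
    exact (hap i (by omega) hi.2).le
  linarith

lemma re_le_add {z w : ℂ} (hw : 0 < w.re) : z.re ≤ (z + w).re := by
  rw [Complex.add_re]; linarith

lemma re_pos_add {z w : ℂ} (hz : 0 < z.re) (hw : 0 < w.re) : 0 < (z + w).re := by
  rw [Complex.add_re]; linarith

lemma re_addI {p : ℂ} (hp : 0 < p.re) (y : ℝ) : 0 < (p + Complex.I * y).re := by simpa using hp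

lemma re_subI {p : ℂ} (hp : 0 < p.re) (y : ℝ) : 0 < (p - Complex.I * y).re := by simpa using hp

lemma mv_subExp {s : ℕ} (hs : 1 ≤ s) (ha : 0 < a.re) (hb : 0 < b.re) (hc : 0 < c.re)
    (hd : 0 < d.re) (hap : ∀ k, 2 ≤ k → k ≤ s → 0 < (ap k).re) (n : ℕ → ℕ) :
    SubExp (gN s) (mvWilson2 a b c d ap s n) := by
  have hN := gN_nonneg s
  unfold mvWilson2
  refine SubExp.mul ?_ (SubExp.prod hN _ _ fun k hk => ?_)
  · have h1 := tail_re (a := a) (b := b) (le_refl 1) hap n c d hc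
    have h2 := tail_re (a := a) (b := b) (le_refl 1) hap n c d hd
    exact SubExp.wilsonP hN (LinB.const hN _) (LinB.const hN _) (LinB.const hN _) (LinB.const hN _)
      (X := fun x : ℕ → ℝ => x 1) (fun x => gN_le (by simp; omega) x) h1
      (fun _ => re_le_add h2)
      (fun _ => re_le_add ha)
      (fun _ => re_le_add hb) _
  · have hk := Finset.mem_Icc.1 hk
    have h1 := tail_re (a := a) (b := b) (show 1 ≤ k by omega) hap n c d hc
    have h2 := tail_re (a := a) (b := b) (show 1 ≤ k by omega) hap n c d hd
    have h3 := hap k hk.1 hk.2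
    have hL := LinB.I_mul (N := gN s) (fun x : ℕ → ℝ => x (k - 1)) (fun x => gN_le (by simp; omega) x)
    exact SubExp.wilsonP hN (LinB.const hN _) (LinB.const hN _) ((LinB.const hN _).add hL)
      ((LinB.const hN _).sub hL)
      (X := fun x : ℕ → ℝ => x k) (fun x => gN_le (by simp; omega) x) h1
      (fun _ => re_le_add h2)
      (fun _ => re_le_add (re_addI h3 _))
      (fun _ => re_le_add (re_subI h3 _)) _

lemma link_eq (p : ℂ) (y x : ℝ) : link p y x = gP p (x + y) * gP p (x - y) * kW y := by
  unfold link gP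
  push_cast
  rw [show p + Complex.I * y + Complex.I * x = p + Complex.I * (x + y) by ring,
    show p + Complex.I * y - Complex.I * x = p - Complex.I * (x - y) by ring,
    show p - Complex.I * y + Complex.I * x = p + Complex.I * (x - y) by ring,
    show p - Complex.I * y - Complex.I * x = p - Complex.I * (x + y) by ring]
  ring

lemma link_bound {p : ℂ} (hp : 0 < p.re) {ε : ℝ} (hε : 0 < ε) (hε' : ε < 2 * Real.pi) :
    ∃ C : ℝ, 0 < C ∧ ∀ y x : ℝ, ‖link p y x‖ ≤
      C * Real.exp (-(2 * Real.pi - ε) * max |x| |y| + (2 * Real.pi + ε) * |y|) := by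
  obtain ⟨C, hC, h1⟩ := gP_bound p.re p.re (Real.pi - ε / 2) hp (by linarith) (by linarith)
  obtain ⟨D, hD, h2⟩ := kW_bound ε hε
  refine ⟨C * C * D, by positivity, fun y x => ?_⟩
  rw [link_eq, norm_mul, norm_mul]
  have hm : 2 * max |x| |y| ≤ |x + y| + |x - y| := by
    rcases max_cases |x| |y| with ⟨h, _⟩ | ⟨h, _⟩ <;> rw [h]
    · have := abs_add_le (x + y) (x - y)
      rw [show x + y + (x - y) = 2 * x by ring, abs_mul, abs_two] at this
      linarith
    · have := abs_sub (x + y) (x - y)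
      rw [show x + y - (x - y) = 2 * y by ring, abs_mul, abs_two] at this
      linarith
  calc _ ≤ (C * Real.exp (-(Real.pi - ε / 2) * |x + y|)) *
        (C * Real.exp (-(Real.pi - ε / 2) * |x - y|)) * (D * Real.exp ((2 * Real.pi + ε) * |y|)) := by
        gcongr
        exacts [h1 p le_rfl le_rfl _, h1 p le_rfl le_rfl _, h2 y]
    _ = C * C * D * (Real.exp (-(Real.pi - ε / 2) * |x + y|) * Real.exp (-(Real.pi - ε / 2) * |x - y|)
        * Real.exp ((2 * Real.pi + ε) * |y|)) := by ring
    _ ≤ _ := by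
        rw [← Real.exp_add, ← Real.exp_add]
        gcongr
        nlinarith

lemma core_bound (ha : 0 < a.re) (hb : 0 < b.re) {s : ℕ} (hs : 1 ≤ s)
    (hap : ∀ k, 2 ≤ k → k ≤ s → 0 < (ap k).re) (ε : ℝ) (hε : 0 < ε) (hε' : ε < 2 * Real.pi) :
    ∃ C : ℝ, 0 < C ∧ ∀ x : ℕ → ℝ, ∀ j ∈ Finset.Icc 1 s,
      ‖core a b ap s x‖ ≤ C * Real.exp (ε * gN s x - 2 * Real.pi * |x j|) := by
  induction s, hs using Nat.le_induction generalizing ε with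
  | base =>
    obtain ⟨C, hC, h1⟩ := gP_bound a.re a.re (Real.pi - ε / 2) ha (by linarith) (by linarith)
    obtain ⟨D, hD, h2⟩ := gP_bound b.re b.re (Real.pi - ε / 2) hb (by linarith) (by linarith)
    refine ⟨C * D, by positivity, fun x j hj => ?_⟩
    have hj : j = 1 := by simpa using hj
    subst hj
    unfold core gN
    simp only [Nat.sub_self, Finset.Icc_eq_empty (show ¬ 1 ≤ 0 by omega), Finset.prod_empty, mul_one,
      Finset.Icc_self, Finset.sum_singleton, norm_mul]
    calc _ ≤ (C * Real.exp (-(Real.pi - ε / 2) * |x 1|)) * (D * Real.exp (-(Real.pi - ε / 2) * |x 1|)) := by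
          gcongr
          exacts [h1 a le_rfl le_rfl _, h2 b le_rfl le_rfl _]
      _ = C * D * (Real.exp (-(Real.pi - ε / 2) * |x 1|) * Real.exp (-(Real.pi - ε / 2) * |x 1|)) := by ring
      _ = _ := by rw [← Real.exp_add]; congr 2; ring
  | succ s hs ih =>
    obtain ⟨C, hC, h1⟩ := ih (fun k h2 h => hap k h2 (by omega)) (ε / 3) (by positivity) (by linarith)
    obtain ⟨D, hD, h2⟩ := link_bound (hap (s + 1) (by omega) le_rfl) (ε := ε / 3) (by positivity) (by linarith)
    refine ⟨C * D, by positivity, fun x j hj => ?_⟩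
    have hj := Finset.mem_Icc.1 hj
    have hNs := gN_le (s := s) (k := s) (by simp; omega) x
    have hN0 := gN_nonneg s x
    have hl := h2 (x s) (x (s + 1))
    have habs := abs_nonneg (x (s + 1))
    have habs' := abs_nonneg (x s)
    have hM1 := le_max_left |x (s + 1)| |x s|
    have hM2 := le_max_right |x (s + 1)| |x s|
    rw [core_succ hs, norm_mul, gN_succ]
    generalize max |x (s + 1)| |x s| = M at *
    rcases Nat.lt_or_ge s j with hlt | hle
    · have hj1 : j = s + 1 := by omega
      subst hj1
      calc _ ≤ (C * Real.exp (ε / 3 * gN s x - 2 * Real.pi * |x s|)) *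
            (D * Real.exp (-(2 * Real.pi - ε / 3) * M + (2 * Real.pi + ε / 3) * |x s|)) :=
            mul_le_mul (h1 x s (by simp; omega)) hl (norm_nonneg _) (by positivity)
        _ = C * D * (Real.exp (ε / 3 * gN s x - 2 * Real.pi * |x s|) *
            Real.exp (-(2 * Real.pi - ε / 3) * M + (2 * Real.pi + ε / 3) * |x s|)) := by ring
        _ ≤ _ := by
          rw [← Real.exp_add]
          gcongr
          have q1 := mul_le_mul_of_nonneg_left hM1 (show 0 ≤ 2 * Real.pi - ε / 3 by linarith)
          have q2 := mul_le_mul_of_nonneg_left hNs hε.le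
          have q3 := mul_nonneg hε.le habs
          have q4 := mul_nonneg hε.le hN0
          linarith
    · calc _ ≤ (C * Real.exp (ε / 3 * gN s x - 2 * Real.pi * |x j|)) *
            (D * Real.exp (-(2 * Real.pi - ε / 3) * M + (2 * Real.pi + ε / 3) * |x s|)) :=
            mul_le_mul (h1 x j (by simp; omega)) hl (norm_nonneg _) (by positivity)
        _ = C * D * (Real.exp (ε / 3 * gN s x - 2 * Real.pi * |x j|) *
            Real.exp (-(2 * Real.pi - ε / 3) * M + (2 * Real.pi + ε / 3) * |x s|)) := by ring
        _ ≤ _ := by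
          rw [← Real.exp_add]
          gcongr
          have q1 := mul_le_mul_of_nonneg_left hM2 (show 0 ≤ 2 * Real.pi - ε / 3 by linarith)
          have q2 := mul_le_mul_of_nonneg_left hNs hε.le
          have q3 := mul_nonneg hε.le habs
          have q4 := mul_nonneg hε.le hN0
          linarith

lemma end_bound (hc : 0 < c.re) (hd : 0 < d.re) (ε : ℝ) (hε : 0 < ε) (hε' : ε < 2 * Real.pi) :
    ∃ C : ℝ, 0 < C ∧ ∀ x : ℝ, ‖gP c x * gP d x * kW x‖ ≤ C * Real.exp (ε * |x|) := by
  obtain ⟨C, hC, h1⟩ := gP_bound c.re c.re (Real.pi - ε / 4) hc (by linarith) (by linarith)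
  obtain ⟨D, hD, h2⟩ := gP_bound d.re d.re (Real.pi - ε / 4) hd (by linarith) (by linarith)
  obtain ⟨E, hE, h3⟩ := kW_bound (ε / 2) (by positivity)
  refine ⟨C * D * E, by positivity, fun x => ?_⟩
  rw [norm_mul, norm_mul]
  calc _ ≤ (C * Real.exp (-(Real.pi - ε / 4) * |x|)) * (D * Real.exp (-(Real.pi - ε / 4) * |x|)) *
        (E * Real.exp ((2 * Real.pi + ε / 2) * |x|)) := by
        gcongr
        exacts [h1 c le_rfl le_rfl _, h2 d le_rfl le_rfl _, h3 x]
    _ = C * D * E * (Real.exp (-(Real.pi - ε / 4) * |x|) * Real.exp (-(Real.pi - ε / 4) * |x|) *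
        Real.exp ((2 * Real.pi + ε / 2) * |x|)) := by ring
    _ = _ := by rw [← Real.exp_add, ← Real.exp_add]; congr 2; ring

lemma rho_bound (ha : 0 < a.re) (hb : 0 < b.re) (hc : 0 < c.re) (hd : 0 < d.re) {s : ℕ} (hs : 1 ≤ s)
    (hap : ∀ k, 2 ≤ k → k ≤ s → 0 < (ap k).re) :
    ∃ C : ℝ, 0 < C ∧ ∀ x : ℕ → ℝ,
      ‖wilsonRho a b c d ap s x‖ ≤ C * Real.exp (-(3 / s) * gN s x) := by
  have hpi := Real.pi_gt_three
  have hs' : (1:ℝ) ≤ s := by exact_mod_cast hs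
  have hε : (0:ℝ) < 1 / s := by positivity
  have hε1 : (1:ℝ) / s ≤ 1 := by rw [div_le_one (by positivity)]; exact hs'
  obtain ⟨C, hC, h1⟩ := core_bound ha hb hs hap (1 / s) hε (by linarith)
  obtain ⟨D, hD, h2⟩ := end_bound hc hd (1 / s) hε (by linarith)
  refine ⟨C * D, by positivity, fun x => ?_⟩
  obtain ⟨j, hj, hjm⟩ : ∃ j ∈ Finset.Icc 1 s, gN s x / s ≤ |x j| := by
    apply Finset.exists_le_of_sum_le ⟨1, by simp; omega⟩
    rw [Finset.sum_const]
    simp only [Nat.card_Icc, Nat.add_sub_cancel, nsmul_eq_mul]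
    rw [mul_div_cancel₀ _ (by positivity)]
    exact le_rfl
  have hN0 := gN_nonneg s x
  have hNs := gN_le (s := s) (k := s) (by simp; omega) x
  rw [rho_core, norm_mul]
  calc _ ≤ (C * Real.exp (1 / s * gN s x - 2 * Real.pi * |x j|)) * (D * Real.exp (1 / s * |x s|)) := by
        gcongr
        exacts [h1 x j hj, h2 (x s)]
    _ = C * D * (Real.exp (1 / s * gN s x - 2 * Real.pi * |x j|) * Real.exp (1 / s * |x s|)) := by ring
    _ ≤ _ := by
      rw [← Real.exp_add]
      gcongr
      have e1 : 1 / s * |x s| ≤ 1 / s * gN s x := by gcongr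
      have e2 : gN s x / s = 1 / s * gN s x := by ring
      have e3 : -(3 / s) * gN s x = -3 * (1 / s * gN s x) := by ring
      rw [e3]
      rw [e2] at hjm
      have : 0 ≤ 1 / s * gN s x := by positivity
      nlinarith

/-- the integrand -/
def FF (a b c d : ℂ) (ap : ℕ → ℂ) (s : ℕ) (n m : ℕ → ℕ) (x : ℕ → ℝ) : ℂ :=
  mvWilson2 a b c d ap s n x * mvWilson2 a b c d ap s m x * wilsonRho a b c d ap s x

lemma FF_bound (ha : 0 < a.re) (hb : 0 < b.re) (hc : 0 < c.re) (hd : 0 < d.re) {s : ℕ} (hs : 1 ≤ s)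
    (hap : ∀ k, 2 ≤ k → k ≤ s → 0 < (ap k).re) (n m : ℕ → ℕ) :
    ∃ C : ℝ, 0 < C ∧ ∀ x : ℕ → ℝ,
      ‖FF a b c d ap s n m x‖ ≤ C * Real.exp (-(1 / s) * gN s x) := by
  have hs' : (1:ℝ) ≤ s := by exact_mod_cast hs
  obtain ⟨C, hC, h1⟩ := ((mv_subExp hs ha hb hc hd hap n).mul (mv_subExp hs ha hb hc hd hap m))
    (2 / s) (by positivity)
  obtain ⟨D, hD, h2⟩ := rho_bound ha hb hc hd hs hap
  refine ⟨C * D, by positivity, fun x => ?_⟩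
  unfold FF
  rw [norm_mul]
  calc _ ≤ (C * Real.exp (2 / s * gN s x)) * (D * Real.exp (-(3 / s) * gN s x)) := by
        gcongr
        exacts [h1 x, h2 x]
    _ = C * D * (Real.exp (2 / s * gN s x) * Real.exp (-(3 / s) * gN s x)) := by ring
    _ = _ := by rw [← Real.exp_add]; congr 2; ring

lemma lift_cont (s k : ℕ) : Continuous (fun y : Fin s → ℝ => lift s y k) := by
  unfold _root_.lift
  by_cases h : k - 1 < s
  · simp only [h, dif_pos]; fun_prop
  · simp only [h, dif_neg, not_false_iff]; fun_prop

lemma gP_comp_cont {α : Type*} [TopologicalSpace α] {p : α → ℂ} {X : α → ℝ} (hp : Continuous p)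
    (hX : Continuous X) (h : ∀ t, 0 < (p t).re) : Continuous (fun t => gP (p t) (X t)) := by
  unfold gP
  refine (gamma_comp_cont (f := fun t => p t + Complex.I * X t) (by fun_prop) ?_).mul
    (gamma_comp_cont (f := fun t => p t - Complex.I * X t) (by fun_prop) ?_)
  · intro t; simpa using h t
  · intro t; simpa using h t

lemma FF_cont (ha : 0 < a.re) (hb : 0 < b.re) (hc : 0 < c.re) (hd : 0 < d.re) {s : ℕ} (hs : 1 ≤ s)
    (hap : ∀ k, 2 ≤ k → k ≤ s → 0 < (ap k).re) (n m : ℕ → ℕ) :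
    Continuous (fun y : Fin s → ℝ => FF a b c d ap s n m (lift s y)) := by
  have hL := lift_cont s
  have hmv : ∀ n : ℕ → ℕ, Continuous (fun y : Fin s → ℝ => mvWilson2 a b c d ap s n (lift s y)) := by
    intro n
    unfold mvWilson2
    refine Continuous.mul ?_ (continuous_finsetProd _ fun k hk => ?_)
    · have h1 := tail_re (a := a) (b := b) (le_refl 1) hap n c d hc
      have h2 := tail_re (a := a) (b := b) (le_refl 1) hap n c d hd
      exact wilsonP_cont continuous_const continuous_const continuous_const continuous_const (hL 1)
        (fun _ => re_pos_add h1 h2)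
        (fun _ => re_pos_add h1 ha)
        (fun _ => re_pos_add h1 hb) _
    · have hk := Finset.mem_Icc.1 hk
      have h1 := tail_re (a := a) (b := b) (show 1 ≤ k by omega) hap n c d hc
      have h2 := tail_re (a := a) (b := b) (show 1 ≤ k by omega) hap n c d hd
      have h3 := hap k hk.1 hk.2
      have hL1 := hL (k - 1)
      exact wilsonP_cont continuous_const continuous_const (by fun_prop) (by fun_prop) (hL k)
        (fun _ => re_pos_add h1 h2)
        (fun _ => re_pos_add h1 (re_addI h3 _))
        (fun _ => re_pos_add h1 (re_subI h3 _)) _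
  unfold FF
  refine ((hmv n).mul (hmv m)).mul ?_
  simp only [rho_core]
  unfold core
  refine (((gP_cont ha).comp (hL 1)).mul ((gP_cont hb).comp (hL 1))).mul
    (continuous_finsetProd _ fun k hk => ?_) |>.mul
    ((((gP_cont hc).comp (hL s)).mul ((gP_cont hd).comp (hL s))).mul (kW_cont.comp (hL s)))
  have hk := Finset.mem_Icc.1 hk
  have h3 := hap (k + 1) (by omega) (by omega)
  have hL1 := hL k
  unfold link
  refine ((gP_comp_cont (by fun_prop) (hL (k + 1)) ?_).mul
    (gP_comp_cont (by fun_prop) (hL (k + 1)) ?_)).mul (kW_cont.comp (hL k))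
  · intro t; simpa using h3
  · intro t; simpa using h3

lemma gN_lift (s : ℕ) (y : Fin s → ℝ) : gN s (lift s y) = ∑ i, |y i| := by
  have h1 : ∀ i : Fin s, |y i| = |lift s y (i + 1)| := by
    intro i
    unfold _root_.lift
    simp
  unfold gN
  rw [Finset.sum_congr rfl fun i _ => h1 i, Fin.sum_univ_eq_sum_range (fun i => |lift s y (i + 1)|) s,
    Finset.range_eq_Ico, Finset.sum_Ico_add' (fun k => |lift s y k|) 0 s 1]
  rfl

lemma FF_integrable (ha : 0 < a.re) (hb : 0 < b.re) (hc : 0 < c.re) (hd : 0 < d.re) {s : ℕ} (hs : 1 ≤ s)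
    (hap : ∀ k, 2 ≤ k → k ≤ s → 0 < (ap k).re) (n m : ℕ → ℕ) :
    Integrable (fun y : Fin s → ℝ => FF a b c d ap s n m (lift s y)) := by
  have hs' : (1:ℝ) ≤ s := by exact_mod_cast hs
  obtain ⟨C, hC, h⟩ := FF_bound ha hb hc hd hs hap n m
  have hI : Integrable (fun y : Fin s → ℝ => ∏ i, Real.exp (-(1 / s : ℝ) * |y i|)) :=
    Integrable.fintype_prod (f := fun (_ : Fin s) (t : ℝ) => Real.exp (-(1 / s : ℝ) * |t|))
      fun _ => integrable_exp_abs (1 / s) (by positivity)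
  refine (hI.const_mul C).mono' (FF_cont ha hb hc hd hs hap n m).aestronglyMeasurable
    (Filter.Eventually.of_forall fun y => ?_)
  refine (h _).trans (le_of_eq ?_)
  rw [gN_lift, Finset.mul_sum, Real.exp_sum]

end bounds

/-! ### Integrating out the last variable -/

lemma fin_peel {s : ℕ} (F : (Fin (s + 1) → ℝ) → ℂ) (hF : Integrable F) :
    ∫ y, F y = ∫ y : Fin s → ℝ, ∫ t : ℝ, F (Fin.snoc (α := fun _ => ℝ) y t) := by
  have hm := (volume_preserving_piFinSuccAbove (fun _ : Fin (s + 1) => ℝ) (Fin.last s)).symm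
  have e : ∀ (t : ℝ) (y : Fin s → ℝ),
      (MeasurableEquiv.piFinSuccAbove (fun _ : Fin (s + 1) => ℝ) (Fin.last s)).symm (t, y) =
        Fin.snoc (α := fun _ => ℝ) y t := by
    intro t y
    simp [MeasurableEquiv.piFinSuccAbove, Fin.insertNthEquiv, Fin.insertNth_last']
  rw [← hm.integral_comp' F]
  have hI := (hm.integrable_comp_emb (MeasurableEquiv.measurableEmbedding _)).2 hF
  rw [Measure.volume_eq_prod] at hI ⊢
  refine (integral_prod_symm _ hI).trans ?_
  congr 1
  funext y
  congr 1
  funext t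
  exact congrArg F (e t y)

lemma lift_snoc_lt {s : ℕ} (y : Fin s → ℝ) (t : ℝ) {k : ℕ} (hk : k ∈ Finset.Icc 1 s) :
    lift (s + 1) (Fin.snoc (α := fun _ => ℝ) y t) k = lift s y k := by
  have hk := Finset.mem_Icc.1 hk
  unfold _root_.lift
  rw [dif_pos (show k - 1 < s + 1 by omega), dif_pos (show k - 1 < s by omega)]
  simp [Fin.snoc, show k - 1 < s by omega]

lemma lift_snoc_last {s : ℕ} (y : Fin s → ℝ) (t : ℝ) :
    lift (s + 1) (Fin.snoc (α := fun _ => ℝ) y t) (s + 1) = t := by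
  unfold _root_.lift
  simp [Fin.snoc]

lemma FF_peel {a b c d : ℂ} {ap : ℕ → ℂ} {s : ℕ} (hs : 1 ≤ s) (n m : ℕ → ℕ) (y : Fin s → ℝ) (t : ℝ) :
    FF a b c d ap (s + 1) n m (lift (s + 1) (Fin.snoc (α := fun _ => ℝ) y t)) =
      (mvWilson2 a b (shf ap s n c) (shf ap s n d) ap s n (lift s y) *
        mvWilson2 a b (shf ap s m c) (shf ap s m d) ap s m (lift s y) *
        (core a b ap s (lift s y) * kW (lift s y s))) *
      (wilsonP c d (ap (s + 1) + Complex.I * lift s y s) (ap (s + 1) - Complex.I * lift s y s) (n (s + 1)) t *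
        wilsonP c d (ap (s + 1) + Complex.I * lift s y s) (ap (s + 1) - Complex.I * lift s y s) (m (s + 1)) t *
        wt c d (ap (s + 1) + Complex.I * lift s y s) (ap (s + 1) - Complex.I * lift s y s) t) := by
  have h := fun k hk => lift_snoc_lt y t (k := k) hk
  unfold FF
  rw [mv_succ n hs, mv_succ m hs, rho_succ hs, lift_snoc_last, h s (by simp; omega),
    mv_congr hs n h, mv_congr hs m h, core_congr hs h]
  ring

lemma shf_re {ap : ℕ → ℂ} {s : ℕ} (n : ℕ → ℕ) {c : ℂ} (hc : 0 < c.re) (hp : 0 < (ap (s + 1)).re) :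
    0 < (shf ap s n c).re := re_add_nat_pos (re_pos_add hc hp) _

lemma main_orth (s : ℕ) (hs : 1 ≤ s) (a b : ℂ) (ap : ℕ → ℂ)
    (ha : 0 < a.re) (hb : 0 < b.re) (n m : ℕ → ℕ)
    (hap : ∀ k, 2 ≤ k → k ≤ s → 0 < (ap k).re) (c d : ℂ) (hc : 0 < c.re) (hd : 0 < d.re) :
    (∫ y : Fin s → ℝ, FF a b c d ap s n m (lift s y)) =
      if ∀ k ∈ Finset.Icc 1 s, n k = m k then lamW2 a b c d ap s n else 0 := by
  induction s, hs using Nat.le_induction generalizing c d with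
  | base =>
    have h := wilson_orth hc hd ha hb (n 1) (m 1)
    have e : ∀ y : Fin 1 → ℝ, FF a b c d ap 1 n m (lift 1 y) =
        (fun x : ℝ => wilsonP c d a b (n 1) x * wilsonP c d a b (m 1) x * wt c d a b x)
          (MeasurableEquiv.funUnique (Fin 1) ℝ y) := by
      intro y
      unfold FF
      rw [mv_one, mv_one, rho_one]
      rfl
    rw [integral_congr_ae (Filter.Eventually.of_forall e)]
    refine ((volume_preserving_funUnique (Fin 1) ℝ).integral_comp' (fun x : ℝ =>
      wilsonP c d a b (n 1) x * wilsonP c d a b (m 1) x * wt c d a b x)).trans ?_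
    rw [h, lam_one]
    simp
  | succ s hs ih =>
    have hp := hap (s + 1) (by omega) le_rfl
    have hap' : ∀ k, 2 ≤ k → k ≤ s → 0 < (ap k).re := fun k h1 h2 => hap k h1 (by omega)
    rw [fin_peel _ (FF_integrable ha hb hc hd (by omega) hap n m)]
    simp only [FF_peel hs, integral_const_mul]
    have hin : ∀ y : Fin s → ℝ, ∫ t : ℝ,
        wilsonP c d (ap (s + 1) + Complex.I * lift s y s) (ap (s + 1) - Complex.I * lift s y s) (n (s + 1)) t *
        wilsonP c d (ap (s + 1) + Complex.I * lift s y s) (ap (s + 1) - Complex.I * lift s y s) (m (s + 1)) t *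
        wt c d (ap (s + 1) + Complex.I * lift s y s) (ap (s + 1) - Complex.I * lift s y s) t = _ :=
      fun y => wilson_orth hc hd (re_addI hp _) (re_subI hp _) (n (s + 1)) (m (s + 1))
    simp only [hin]
    by_cases hnm : n (s + 1) = m (s + 1)
    · simp only [if_pos hnm, wnorm_link]
      have hsh : ∀ e, shf ap s m e = shf ap s n e := by intro e; unfold shf; rw [hnm]
      have hF : ∀ y : Fin s → ℝ,
          mvWilson2 a b (shf ap s n c) (shf ap s n d) ap s n (lift s y) *
          mvWilson2 a b (shf ap s m c) (shf ap s m d) ap s m (lift s y) *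
          (core a b ap s (lift s y) * kW (lift s y s)) *
          (kap c d (ap (s + 1)) (n (s + 1)) * (gP (c + ap (s + 1) + n (s + 1)) (lift s y s) *
            gP (d + ap (s + 1) + n (s + 1)) (lift s y s))) =
          kap c d (ap (s + 1)) (n (s + 1)) *
            FF a b (shf ap s n c) (shf ap s n d) ap s n m (lift s y) := by
        intro y
        unfold FF
        rw [rho_core, hsh, hsh]
        unfold shf
        ring
      simp only [hF]
      rw [integral_const_mul, ih hap' _ _ (shf_re n hc hp) (shf_re n hd hp), lam_succ n hs]
      have hiff : (∀ k ∈ Finset.Icc 1 (s + 1), n k = m k) ↔ ∀ k ∈ Finset.Icc 1 s, n k = m k := by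
        constructor
        · intro h k hk
          have := Finset.mem_Icc.1 hk
          exact h k (Finset.mem_Icc.2 ⟨this.1, by omega⟩)
        · intro h k hk
          have := Finset.mem_Icc.1 hk
          rcases Nat.lt_or_ge s k with hlt | hle
          · have : k = s + 1 := by omega
            rw [this]; exact hnm
          · exact h k (Finset.mem_Icc.2 ⟨this.1, hle⟩)
      by_cases hk : ∀ k ∈ Finset.Icc 1 s, n k = m k
      · rw [if_pos hk, if_pos (hiff.2 hk)]
      · rw [if_neg hk, if_neg (fun h => hk (hiff.1 h)), mul_zero]
    · simp only [if_neg hnm, mul_zero, integral_zero]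
      rw [if_neg]
      intro h
      exact hnm (h (s + 1) (Finset.mem_Icc.2 ⟨by omega, le_rfl⟩))

/-- Orthogonality of Tratnik's second system of multivariable Wilson polynomials. -/
theorem mvWilson_second_orthogonality (s : ℕ) (hs : 1 ≤ s) (a b c d : ℂ) (ap : ℕ → ℂ)
    (ha : 0 < a.re) (hb : 0 < b.re) (hc : 0 < c.re) (hd : 0 < d.re)
    (hap : ∀ k, 2 ≤ k → k ≤ s → 0 < (ap k).re)
    (n m : ℕ → ℕ) :
    (∫ y : Fin s → ℝ,
        mvWilson2 a b c d ap s n (lift s y) * mvWilson2 a b c d ap s m (lift s y) *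
          wilsonRho a b c d ap s (lift s y)) =
      if ∀ k ∈ Finset.Icc 1 s, n k = m k then lamW2 a b c d ap s n else 0 := by
  exact main_orth s hs a b ap ha hb n m hap c d hc hd
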